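/- Let K be a dense additive subgroup of ℝ. Every N-bounded FO_K formula with one free variable is equivalent to an MTL_K formula. -/

import Mathlib

namespace MTLPaper

variable {K : AddSubgroup ℝ} {P : Type}

/-- `K ⊆ ℝ` is dense: between any two elements of `K` there is another element of `K`. -/
def DenseK (K : AddSubgroup ℝ) : Prop :=
  ∀ a ∈ K, ∀ b ∈ K, a < b → ∃ c ∈ K, a < c ∧ c < b

/-- A term of `FO_K`: a variable index together with a constant shift from `K`
(`(x, c)` denotes the term `x + c`; iterated shifts collapse since `K` is a group). -/
abbrev Term (K : AddSubgroup ℝ) : Type := ℕ × K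

/-- Value of a term under a valuation of the variables. -/
def Term.val (v : ℕ → ℝ) (t : Term K) : ℝ := v t.1 + (t.2 : ℝ)

/-- Formulas of the monadic logic of order and metric `FO_K`, over monadic predicates `P`. -/
inductive FO (K : AddSubgroup ℝ) (P : Type) : Type
  | tt : FO K P
  | atom : P → Term K → FO K P
  | lt : Term K → Term K → FO K P
  | conj : FO K P → FO K P → FO K P
  | neg : FO K P → FO K P
  | ex : ℕ → FO K P → FO K P

namespace FO

/-- Satisfaction of an `FO_K` formula over a signal `f` and a valuation `v`. -/
def sat (f : ℝ → Set P) : FO K P → (ℕ → ℝ) → Prop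
  | tt, _ => True
  | atom p t, v => p ∈ f (Term.val v t)
  | lt s t, v => Term.val v s < Term.val v t
  | conj φ ψ, v => sat f φ v ∧ sat f ψ v
  | neg φ, v => ¬ sat f φ v
  | ex x φ, v => ∃ r : ℝ, sat f φ (Function.update v x r)

/-- Free variables of an `FO_K` formula. -/
def free : FO K P → Set ℕ
  | tt => ∅
  | atom _ t => {t.1}
  | lt s t => {s.1, t.1}
  | conj φ ψ => free φ ∪ free ψ
  | neg φ => free φ
  | ex x φ => free φ \ {x}

/-- Quantifier depth. -/
def qdepth : FO K P → ℕ
  | tt => 0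
  | atom _ _ => 0
  | lt _ _ => 0
  | conj φ ψ => max (qdepth φ) (qdepth ψ)
  | neg φ => qdepth φ
  | ex _ φ => qdepth φ + 1

/-- Quantifier-free formulas. -/
def QFree : FO K P → Prop
  | tt => True
  | atom _ _ => True
  | lt _ _ => True
  | conj φ ψ => QFree φ ∧ QFree ψ
  | neg φ => QFree φ
  | ex _ _ => False

/-- `<`-free formulas. -/
def LtFree : FO K P → Prop
  | tt => True
  | atom _ _ => True
  | lt _ _ => False
  | conj φ ψ => LtFree φ ∧ LtFree ψ
  | neg φ => LtFree φ
  | ex _ φ => LtFree φ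

/-- Membership in `Bet_K(t₁,t₂)`: every quantified subformula `∃z ψ` has the form
`∃z ((t₁ < z < t₂) ∧ χ)`, and every monadic atom `P(t)` has `t` a bound occurrence of a
variable (no shift).  `B` records the set of variables bound so far. -/
def Bet (t₁ t₂ : Term K) : FO K P → Set ℕ → Prop
  | tt, _ => True
  | atom _ t, B => t.2 = (0 : K) ∧ t.1 ∈ B
  | lt _ _, _ => True
  | conj φ ψ, B => Bet t₁ t₂ φ B ∧ Bet t₁ t₂ ψ B
  | neg φ, B => Bet t₁ t₂ φ B
  | ex z (conj (conj (lt s u) (lt u' t)) χ), B =>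
      s = t₁ ∧ t = t₂ ∧ u = (z, (0 : K)) ∧ u' = (z, (0 : K)) ∧ Bet t₁ t₂ χ (insert z B)
  | ex _ _, _ => False

/-- `φ(x)` is `N`-bounded: it belongs to `Bet_K(x - N, x + N)`. -/
def NBounded (x : ℕ) (N : K) (φ : FO K P) : Prop :=
  Bet (x, -N) (x, N) φ (∅ : Set ℕ)

/-- The relativized quantifier `∃ y ∈ (s, t). φ`. -/
def guard (s t : Term K) (y : ℕ) (φ : FO K P) : FO K P :=
  ex y (conj (conj (lt s (y, (0 : K))) (lt (y, (0 : K)) t)) φ)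

/-- The guard interval of the body of a quantifier on `z`, if it has guarded shape. -/
def guardOf (z : ℕ) : FO K P → Set (Term K × Term K)
  | conj (conj (lt s u) (lt u' t)) _ =>
      {p | u = (z, (0 : K)) ∧ u' = (z, (0 : K)) ∧ p = (s, t)}
  | _ => ∅

/-- The guard intervals occurring in a formula. -/
def intervals : FO K P → Set (Term K × Term K)
  | tt => ∅
  | atom _ _ => ∅
  | lt _ _ => ∅
  | conj φ ψ => intervals φ ∪ intervals ψ
  | neg φ => intervals φ
  | ex z φ => guardOf z φ ∪ intervals φ

/-- Hierarchical Interval Formulas (HIFs).  Every `<`-free quantifier-free formula is a HIF;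
HIFs are closed under negation and disjunction (`φ ∨ ψ := ¬(¬φ ∧ ¬ψ)`); and if `φ(x̄, y)` is a
HIF such that the only guard intervals in `φ` involving `y` and a variable free in `φ` are of
the form `(x_l + c_l + c, y + c)` or `(y + c, x_r + c_r + c)` for some `c ∈ K`, then
`∃ y ∈ (x_l + c_l, x_r + c_r). φ` is a HIF. -/
inductive IsHIF : FO K P → Prop
  | base {φ : FO K P} : QFree φ → LtFree φ → IsHIF φ
  | negI {φ : FO K P} : IsHIF φ → IsHIF (neg φ)
  | disjI {φ ψ : FO K P} : IsHIF φ → IsHIF ψ → IsHIF (neg (conj (neg φ) (neg ψ)))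
  | exI {φ : FO K P} {y xl xr : ℕ} {cl cr : K} :
      IsHIF φ → xl ≠ y → xr ≠ y →
      (∀ s t : Term K, (s, t) ∈ intervals φ →
        (s.1 = y → t.1 ≠ y → t.1 ∈ free φ → ∃ c : K, s = (y, c) ∧ t = (xr, cr + c)) ∧
        (t.1 = y → s.1 ≠ y → s.1 ∈ free φ → ∃ c : K, t = (y, c) ∧ s = (xl, cl + c))) →
      IsHIF (guard (xl, cl) (xr, cr) y φ)

/-- A conjunction of constraints of the form `x_j + c < x_k + c'`. -/
def IsConstraintConj : FO K P → Prop
  | tt => True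
  | atom _ _ => False
  | lt _ _ => True
  | conj φ ψ => IsConstraintConj φ ∧ IsConstraintConj ψ
  | neg _ => False
  | ex _ _ => False

/-- The term `t` applies no nonzero shift unless its variable is `x`. -/
def TermOnly (x : ℕ) (t : Term K) : Prop := t.2 = (0 : K) ∨ t.1 = x

/-- The unary functions `+c` are applied only to the variable `x`. -/
def FnOnly (x : ℕ) : FO K P → Prop
  | tt => True
  | atom _ t => TermOnly x t
  | lt s t => TermOnly x s ∧ TermOnly x t
  | conj φ ψ => FnOnly x φ ∧ FnOnly x ψ
  | neg φ => FnOnly x φ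
  | ex _ φ => FnOnly x φ

end FO

/-- Equivalence of two `FO_K` formulas: same truth value for every signal and valuation. -/
def EquivFO (φ ψ : FO K P) : Prop :=
  ∀ (f : ℝ → Set P) (v : ℕ → ℝ), φ.sat f v ↔ ψ.sat f v

/-- An interval `I ⊆ (0,∞)` with endpoints in `K_{≥0} ∪ {∞}` (`hi = none` means `∞`). -/
structure MTLI (K : AddSubgroup ℝ) where
  lo : ℝ
  lo_mem : lo ∈ K
  lo_nonneg : 0 ≤ lo
  loClosed : Bool
  hi : Option ℝ
  hi_mem : ∀ h : ℝ, hi = some h → h ∈ K ∧ 0 ≤ h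
  hiClosed : Bool
  pos : lo = 0 → loClosed = false

namespace MTLI

/-- Membership in the interval. -/
def mem (I : MTLI K) (t : ℝ) : Prop :=
  (if I.loClosed then I.lo ≤ t else I.lo < t) ∧
  ∀ h : ℝ, I.hi = some h → (if I.hiClosed then t ≤ h else t < h)

/-- The interval is bounded. -/
def Bounded (I : MTLI K) : Prop := I.hi ≠ none

/-- The supremum of the interval, in `ℝ ∪ {∞}`. -/
def supW (I : MTLI K) : WithTop ℝ :=
  match I.hi with
  | none => ⊤
  | some h => (h : WithTop ℝ)

/-- The singleton (punctual) interval `{N}`, for `N ∈ K`, `N > 0`. -/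
def single (N : ℝ) (hm : N ∈ K) (h0 : 0 < N) : MTLI K where
  lo := N
  lo_mem := hm
  lo_nonneg := h0.le
  loClosed := true
  hi := some N
  hi_mem := fun h hh => by
    obtain rfl := (Option.some.inj hh).symm
    exact ⟨hm, h0.le⟩
  hiClosed := true
  pos := fun h => absurd h h0.ne'

/-- The unconstrained interval `(0, ∞)`. -/
def full : MTLI K where
  lo := 0
  lo_mem := zero_mem K
  lo_nonneg := le_refl 0
  loClosed := false
  hi := none
  hi_mem := fun _ hh => nomatch hh
  hiClosed := false
  pos := fun _ => rfl

end MTLI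

/-- Formulas of `MTL_K` over atomic propositions `P`. -/
inductive MTL (K : AddSubgroup ℝ) (P : Type) : Type
  | tt : MTL K P
  | atom : P → MTL K P
  | conj : MTL K P → MTL K P → MTL K P
  | neg : MTL K P → MTL K P
  | untl : MTL K P → MTL K P → MTLI K → MTL K P
  | sinc : MTL K P → MTL K P → MTLI K → MTL K P

namespace MTL

/-- Satisfaction of an `MTL_K` formula over a signal, at a point.
`untl φ ψ I` is `φ U_I ψ` and `sinc φ ψ I` is `φ S_I ψ`. -/
def sat (f : ℝ → Set P) : MTL K P → ℝ → Prop
  | tt, _ => True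
  | atom p, r => p ∈ f r
  | conj φ ψ, r => sat f φ r ∧ sat f ψ r
  | neg φ, r => ¬ sat f φ r
  | untl φ ψ I, r =>
      ∃ t : ℝ, r < t ∧ I.mem (t - r) ∧ sat f ψ t ∧ ∀ u, r < u → u < t → sat f φ u
  | sinc φ ψ I, r =>
      ∃ t : ℝ, t < r ∧ I.mem (r - t) ∧ sat f ψ t ∧ ∀ u, t < u → u < r → sat f φ u

/-- All intervals occurring in the temporal operators are bounded. -/
def AllBounded : MTL K P → Prop
  | tt => True
  | atom _ => True
  | conj φ ψ => AllBounded φ ∧ AllBounded ψ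
  | neg φ => AllBounded φ
  | untl φ ψ I => I.Bounded ∧ AllBounded φ ∧ AllBounded ψ
  | sinc φ ψ I => I.Bounded ∧ AllBounded φ ∧ AllBounded ψ

/-- LTL formulas: MTL formulas using only the interval `(0, ∞)`. -/
def IsLTL : MTL K P → Prop
  | tt => True
  | atom _ => True
  | conj φ ψ => IsLTL φ ∧ IsLTL ψ
  | neg φ => IsLTL φ
  | untl φ ψ I => I = MTLI.full ∧ IsLTL φ ∧ IsLTL ψ
  | sinc φ ψ I => I = MTLI.full ∧ IsLTL φ ∧ IsLTL ψ

/-- Future reach. -/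
noncomputable def fr : MTL K P → WithTop ℝ
  | tt => 0
  | atom _ => 0
  | conj φ ψ => max (fr φ) (fr ψ)
  | neg φ => fr φ
  | untl φ ψ I => I.supW + max (fr φ) (fr ψ)
  | sinc φ ψ I => max (fr φ) (WithTop.map (fun x => x - I.lo) (fr ψ))

/-- Past reach. -/
noncomputable def pr : MTL K P → WithTop ℝ
  | tt => 0
  | atom _ => 0
  | conj φ ψ => max (pr φ) (pr ψ)
  | neg φ => pr φ
  | untl φ ψ I => max (pr φ) (WithTop.map (fun x => x - I.lo) (pr ψ))
  | sinc φ ψ I => I.supW + max (pr φ) (pr ψ)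

/-- Boolean combinations of formulas from a class `S`. -/
inductive BC (S : MTL K P → Prop) : MTL K P → Prop
  | base {φ : MTL K P} : S φ → BC S φ
  | negB {φ : MTL K P} : BC S φ → BC S (neg φ)
  | conjB {φ ψ : MTL K P} : BC S φ → BC S ψ → BC S (conj φ ψ)

end MTL

/-- Equivalence of two `MTL_K` formulas. -/
def EquivMTL (φ ψ : MTL K P) : Prop :=
  ∀ (f : ℝ → Set P) (r : ℝ), φ.sat f r ↔ ψ.sat f r

/-- Equivalence of an `FO_K` formula with (at most) free variable `0` and an `MTL_K` formula. -/
def EquivFOMTL (φ : FO K P) (ψ : MTL K P) : Prop :=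
  ∀ (f : ℝ → Set P) (r : ℝ), φ.sat f (fun _ => r) ↔ ψ.sat f r

/-- `MTL_K` and `FO_K` have the same expressive power. -/
def SameExpressive (K : AddSubgroup ℝ) (P : Type) : Prop :=
  (∀ φ : FO K P, φ.free ⊆ {0} → ∃ ψ : MTL K P, EquivFOMTL φ ψ) ∧
  (∀ ψ : MTL K P, ∃ φ : FO K P, φ.free ⊆ {0} ∧ EquivFOMTL φ ψ)

/-- Formulas of `MTL_K` with counting modalities. -/
inductive MTLC (K : AddSubgroup ℝ) (P : Type) : Type
  | tt : MTLC K P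
  | atom : P → MTLC K P
  | conj : MTLC K P → MTLC K P → MTLC K P
  | neg : MTLC K P → MTLC K P
  | untl : MTLC K P → MTLC K P → MTLI K → MTLC K P
  | sinc : MTLC K P → MTLC K P → MTLI K → MTLC K P
  | fcount : ℕ → MTLC K P → MTLC K P
  | pcount : ℕ → MTLC K P → MTLC K P

namespace MTLC

/-- Satisfaction of an `MTL_K+C` formula. -/
def sat (f : ℝ → Set P) : MTLC K P → ℝ → Prop
  | tt, _ => True
  | atom p, r => p ∈ f r
  | conj φ ψ, r => sat f φ r ∧ sat f ψ r
  | neg φ, r => ¬ sat f φ r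
  | untl φ ψ I, r =>
      ∃ t : ℝ, r < t ∧ I.mem (t - r) ∧ sat f ψ t ∧ ∀ u, r < u → u < t → sat f φ u
  | sinc φ ψ I, r =>
      ∃ t : ℝ, t < r ∧ I.mem (r - t) ∧ sat f ψ t ∧ ∀ u, t < u → u < r → sat f φ u
  | fcount n φ, r =>
      ∃ s : Fin n → ℝ, StrictMono s ∧ ∀ i, s i ∈ Set.Ioo r (r + 1) ∧ sat f φ (s i)
  | pcount n φ, r =>
      ∃ s : Fin n → ℝ, StrictMono s ∧ ∀ i, s i ∈ Set.Ioo (r - 1) r ∧ sat f φ (s i)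

end MTLC

/-- The integers, as an additive subgroup of `ℝ`. -/
def intZ : AddSubgroup ℝ := AddSubgroup.zmultiples (1 : ℝ)

/-- Equivalence of an `FO_K` formula with free variable `0` and an `MTL_K+C` formula. -/
def EquivFOMTLC (φ : FO K P) (ψ : MTLC K P) : Prop :=
  ∀ (f : ℝ → Set P) (r : ℝ), φ.sat f (fun _ => r) ↔ ψ.sat f r

/-- Formulas of PQ2MLO: Q2MLO with punctuality. -/
inductive PQ (P : Type) : Type
  | tt : PQ P
  | atom : P → ℕ → PQ P
  | lt : ℕ → ℕ → PQ P
  | conj : PQ P → PQ P → PQ P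
  | neg : PQ P → PQ P
  | ex : ℕ → PQ P → PQ P
  | exFutI : ℕ → ℕ → PQ P → PQ P  -- ∃ y ∈ (x, x+1). ψ
  | exPastI : ℕ → ℕ → PQ P → PQ P -- ∃ y ∈ (x-1, x). ψ
  | exFutP : ℕ → ℕ → PQ P → PQ P  -- ∃ y (y = x+1 ∧ χ)
  | exPastP : ℕ → ℕ → PQ P → PQ P -- ∃ y (y = x-1 ∧ χ)

namespace PQ

/-- Satisfaction of a PQ2MLO formula. -/
def sat (f : ℝ → Set P) : PQ P → (ℕ → ℝ) → Prop
  | tt, _ => True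
  | atom p x, v => p ∈ f (v x)
  | lt x y, v => v x < v y
  | conj φ ψ, v => sat f φ v ∧ sat f ψ v
  | neg φ, v => ¬ sat f φ v
  | ex x φ, v => ∃ r : ℝ, sat f φ (Function.update v x r)
  | exFutI x y ψ, v => ∃ r : ℝ, v x < r ∧ r < v x + 1 ∧ sat f ψ (Function.update v y r)
  | exPastI x y ψ, v => ∃ r : ℝ, v x - 1 < r ∧ r < v x ∧ sat f ψ (Function.update v y r)
  | exFutP x y χ, v => ∃ r : ℝ, r = v x + 1 ∧ sat f χ (Function.update v y r)
  | exPastP x y χ, v => ∃ r : ℝ, r = v x - 1 ∧ sat f χ (Function.update v y r)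

/-- Free variables of a PQ2MLO formula. -/
def free : PQ P → Set ℕ
  | tt => ∅
  | atom _ x => {x}
  | lt x y => {x, y}
  | conj φ ψ => free φ ∪ free ψ
  | neg φ => free φ
  | ex x φ => free φ \ {x}
  | exFutI x y ψ => insert x (free ψ \ {y})
  | exPastI x y ψ => insert x (free ψ \ {y})
  | exFutP x y χ => insert x (free χ \ {y})
  | exPastP x y χ => insert x (free χ \ {y})

/-- Well-formedness: in `∃y∈(x,x+1) ψ` and `∃y∈(x-1,x) ψ` the formula `ψ` has exactly the
free variables `x` and `y`; in `∃y (y = x±1 ∧ χ)` the formula `χ` has exactly the free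
variable `y`. -/
def WF : PQ P → Prop
  | tt => True
  | atom _ _ => True
  | lt _ _ => True
  | conj φ ψ => WF φ ∧ WF ψ
  | neg φ => WF φ
  | ex _ φ => WF φ
  | exFutI x y ψ => x ≠ y ∧ free ψ = {x, y} ∧ WF ψ
  | exPastI x y ψ => x ≠ y ∧ free ψ = {x, y} ∧ WF ψ
  | exFutP x y χ => x ≠ y ∧ free χ = {y} ∧ WF χ
  | exPastP x y χ => x ≠ y ∧ free χ = {y} ∧ WF χ

end PQ

/-- Equivalence of an `FO_ℤ` formula with free variable `0` and a PQ2MLO formula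
with free variable `0`. -/
def EquivFOPQ (φ : FO intZ P) (π : PQ P) : Prop :=
  ∀ (f : ℝ → Set P) (r : ℝ), φ.sat f (fun _ => r) ↔ π.sat f (fun _ => r)

/-- Equivalence of a PQ2MLO formula with free variable `0` and an `MTL_ℤ+C` formula. -/
def EquivPQMTLC (π : PQ P) (ψ : MTLC intZ P) : Prop :=
  ∀ (f : ℝ → Set P) (r : ℝ), π.sat f (fun _ => r) ↔ ψ.sat f r

/-- The singleton interval `{1}` over the integer constants. -/
def oneI : MTLI intZ := MTLI.single 1 (AddSubgroup.mem_zmultiples (1 : ℝ)) one_pos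

/-- The interpretation of the enlarged set of monadic predicates: the predicate `(p, c)`
(i.e. `P^c`) holds at `r` iff `p` holds at `r + c`. -/
def liftSig (K : AddSubgroup ℝ) (f : ℝ → Set P) : ℝ → Set (P × K) :=
  fun r => {pc : P × K | pc.1 ∈ f (r + (pc.2 : ℝ))}

/-- Semantics of a decomposition formula `δ(x,y)`:
`x < y ∧ ∃ z₀ … zₙ (x = z₀ < ⋯ < zₙ = y) ∧ ⋀ φᵢ(zᵢ) ∧ ⋀ ∀u (z_{i-1} < u < z_i → ψᵢ(u))`,
where the `φᵢ`, `ψᵢ` are MTL formulas regarded as unary predicates. -/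
def DecompSat (f : ℝ → Set P) (n : ℕ) (φ ψ : ℕ → MTL K P) (x y : ℝ) : Prop :=
  x < y ∧ ∃ z : ℕ → ℝ, z 0 = x ∧ z n = y ∧ (∀ i < n, z i < z (i + 1)) ∧
    (∀ i, 0 < i → i < n → (φ i).sat f (z i)) ∧
    (∀ i, 0 < i → i ≤ n → ∀ u, z (i - 1) < u → u < z i → (ψ i).sat f u)

/-- Semantics of `δ(x,y)` for abstract unary predicates (no `x < y` conjunct). -/
def Delta (φ ψ : ℕ → ℝ → Prop) (n : ℕ) (x y : ℝ) : Prop :=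
  ∃ z : ℕ → ℝ, z 0 = x ∧ z n = y ∧ (∀ i < n, z i < z (i + 1)) ∧
    (∀ i, 0 < i → i < n → φ i (z i)) ∧
    (∀ i, 0 < i → i ≤ n → ∀ u, z (i - 1) < u → u < z i → ψ i u)

/-- Semantics of `δⱼ(x,y)`: the restriction of `δ` to the first `j` formulas of
`ψ₁, φ₁, ψ₂, φ₂, …, ψₙ`, with `k = ⌈j/2⌉` existential quantifiers after `z₀`. -/
def DeltaJ (φ ψ : ℕ → ℝ → Prop) (j : ℕ) (x y : ℝ) : Prop :=
  ∃ z : ℕ → ℝ, z 0 = x ∧ z ((j + 1) / 2) = y ∧ (∀ i < (j + 1) / 2, z i < z (i + 1)) ∧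
    (∀ i, 0 < i → i ≤ j / 2 → φ i (z i)) ∧
    (∀ i, 0 < i → i ≤ (j + 1) / 2 → ∀ u, z (i - 1) < u → u < z i → ψ i u)

/-- The three kinds of formulas in the separation lemma, for the constant `c`:
`◇_{{N}} θ` with `pr θ < N - c`; `◇⁻_{{N}} θ` with `fr θ < N - c`; and formulas in which
all intervals of temporal operators are bounded. -/
def SepKind (c : ℝ) (χ : MTL K P) : Prop :=
  (∃ (N : ℝ) (hm : N ∈ K) (h0 : 0 < N) (θ : MTL K P),
      χ = MTL.untl MTL.tt θ (MTLI.single N hm h0) ∧ θ.pr < ((N - c : ℝ) : WithTop ℝ)) ∨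
  (∃ (N : ℝ) (hm : N ∈ K) (h0 : 0 < N) (θ : MTL K P),
      χ = MTL.sinc MTL.tt θ (MTLI.single N hm h0) ∧ θ.fr < ((N - c : ℝ) : WithTop ℝ)) ∨
  χ.AllBounded


namespace MTL

/-- Falsity. -/
def ff : MTL K P := neg tt

/-- Disjunction. -/
def disj (φ ψ : MTL K P) : MTL K P := neg (conj (neg φ) (neg ψ))

@[simp] lemma sat_tt (f : ℝ → Set P) (r : ℝ) : (tt : MTL K P).sat f r := trivial

@[simp] lemma sat_conj (f : ℝ → Set P) (φ ψ : MTL K P) (r : ℝ) :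
    (conj φ ψ).sat f r ↔ φ.sat f r ∧ ψ.sat f r := Iff.rfl

@[simp] lemma sat_neg (f : ℝ → Set P) (φ : MTL K P) (r : ℝ) :
    (neg φ).sat f r ↔ ¬ φ.sat f r := Iff.rfl

@[simp] lemma sat_ff (f : ℝ → Set P) (r : ℝ) : ¬ (ff : MTL K P).sat f r := by simp [ff]

@[simp] lemma sat_disj (f : ℝ → Set P) (φ ψ : MTL K P) (r : ℝ) :
    (disj φ ψ).sat f r ↔ φ.sat f r ∨ ψ.sat f r := by
  simp only [disj, sat_neg, sat_conj]; tauto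

end MTL

namespace MTLI

/-- The interval `(0, d)`. -/
def upto (d : K) (hd : 0 < (d : ℝ)) : MTLI K where
  lo := 0
  lo_mem := zero_mem K
  lo_nonneg := le_refl 0
  loClosed := false
  hi := some d
  hi_mem := fun h hh => by
    obtain rfl := (Option.some.inj hh).symm
    exact ⟨d.2, hd.le⟩
  hiClosed := false
  pos := fun _ => rfl

@[simp] lemma mem_full (t : ℝ) : (full : MTLI K).mem t ↔ 0 < t := by
  simp [mem, full]

@[simp] lemma mem_upto (d : K) (hd : 0 < (d : ℝ)) (t : ℝ) :
    (upto d hd).mem t ↔ 0 < t ∧ t < d := by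
  simp [mem, upto]

@[simp] lemma mem_single (c : ℝ) (hc : c ∈ K) (h0 : 0 < c) (t : ℝ) :
    (single c hc h0).mem t ↔ t = c := by
  simp only [mem, single, ↓reduceIte, Option.some.injEq, forall_eq']
  exact le_antisymm_iff.symm.trans eq_comm

end MTLI

/-- `q` holds throughout the open interval `(a, b)`. -/
def HoldsOn (f : ℝ → Set P) (q : MTL K P) (a b : ℝ) : Prop :=
  ∀ u, a < u → u < b → q.sat f u

lemma HoldsOn.mono {f : ℝ → Set P} {q : MTL K P} {a b a' b' : ℝ} (h : HoldsOn f q a b)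
    (ha : a ≤ a') (hb : b' ≤ b) : HoldsOn f q a' b' :=
  fun u hu hu' => h u (ha.trans_lt hu) (hu'.trans_le hb)

lemma holdsOn_split {f : ℝ → Set P} {q : MTL K P} {a b c : ℝ} (hac : a < c) (hcb : c < b) :
    HoldsOn f q a b ↔ HoldsOn f q a c ∧ q.sat f c ∧ HoldsOn f q c b := by
  refine ⟨fun h => ⟨h.mono le_rfl hcb.le, h c hac hcb, h.mono hac.le le_rfl⟩, ?_⟩
  rintro ⟨h1, h2, h3⟩ u hu hu'
  rcases lt_trichotomy u c with h | rfl | h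
  exacts [h1 u hu h, h2, h3 u h hu']

lemma holdsOn_conj {f : ℝ → Set P} {q q' : MTL K P} {a b : ℝ} :
    HoldsOn f (.conj q q') a b ↔ HoldsOn f q a b ∧ HoldsOn f q' a b := by
  simp only [HoldsOn, MTL.sat_conj]
  exact ⟨fun h => ⟨fun u x y => (h u x y).1, fun u x y => (h u x y).2⟩,
    fun h u x y => ⟨h.1 u x y, h.2 u x y⟩⟩

@[simp] lemma holdsOn_tt {f : ℝ → Set P} {a b : ℝ} : HoldsOn f (.tt : MTL K P) a b :=
  fun _ _ _ => trivial

namespace MTL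

@[simp] lemma sat_untl (f : ℝ → Set P) (φ ψ : MTL K P) (I : MTLI K) (r : ℝ) :
    (untl φ ψ I).sat f r ↔ ∃ t, r < t ∧ I.mem (t - r) ∧ ψ.sat f t ∧ HoldsOn f φ r t := Iff.rfl

@[simp] lemma sat_sinc (f : ℝ → Set P) (φ ψ : MTL K P) (I : MTLI K) (r : ℝ) :
    (sinc φ ψ I).sat f r ↔ ∃ t, t < r ∧ I.mem (r - t) ∧ ψ.sat f t ∧ HoldsOn f φ t r := Iff.rfl

/-- `q` fails arbitrarily closely to the right. -/
def gapR (q : MTL K P) : MTL K P := neg (untl q tt .full)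

/-- `q` fails arbitrarily closely to the left. -/
def gapL (q : MTL K P) : MTL K P := neg (sinc q tt .full)

lemma sat_gapR (f : ℝ → Set P) (q : MTL K P) (r : ℝ) :
    (gapR q).sat f r ↔ ¬ ∃ t, r < t ∧ HoldsOn f q r t := by
  simp +contextual [gapR]

lemma sat_gapL (f : ℝ → Set P) (q : MTL K P) (r : ℝ) :
    (gapL q).sat f r ↔ ¬ ∃ t, t < r ∧ HoldsOn f q t r := by
  simp +contextual [gapL]

/-- The formula asserting `φ` at distance `c` (of either sign). -/
noncomputable def shift (c : K) (φ : MTL K P) : MTL K P :=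
  if h : 0 < (c : ℝ) then untl tt φ (.single c c.2 h)
  else if h : 0 < ((-c : K) : ℝ) then sinc tt φ (.single (-c : K) (-c).2 h)
  else φ

@[simp] lemma sat_shift (f : ℝ → Set P) (c : K) (φ : MTL K P) (r : ℝ) :
    (shift c φ).sat f r ↔ φ.sat f (r + c) := by
  unfold shift
  split_ifs with h h'
  · simp only [sat_untl, MTLI.mem_single, holdsOn_tt, and_true]
    constructor
    · rintro ⟨t, -, h2, h3⟩
      rwa [← h2, add_sub_cancel]
    · exact fun h3 => ⟨r + c, by linarith, by ring, h3⟩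
  · simp only [sat_sinc, MTLI.mem_single, holdsOn_tt, and_true]
    push_cast at h' ⊢
    constructor
    · rintro ⟨t, -, h2, h3⟩
      have : r + c = t := by linarith
      rwa [this]
    · exact fun h3 => ⟨r + c, by linarith, by ring, h3⟩
  · push_cast at h'
    have : (c : ℝ) = 0 := by linarith
    rw [this, add_zero]

end MTL

/-- A property of reals on `(a, b)` either fails arbitrarily closely to the right of `a`, or has a
first point of failure inside `(a, b)`, or holds throughout. -/
lemma first_failure (q : ℝ → Prop) {a b : ℝ} (hab : a < b) :
    (¬ ∃ t, a < t ∧ ∀ u, a < u → u < t → q u) ∨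
    (∃ c, a < c ∧ c < b ∧ (∀ u, a < u → u < c → q u) ∧
      (¬ q c ∨ ¬ ∃ t, c < t ∧ ∀ u, c < u → u < t → q u)) ∨
    ∀ u, a < u → u < b → q u := by
  by_cases h : ∃ t, a < t ∧ ∀ u, a < u → u < t → q u
  swap
  · exact Or.inl h
  right
  obtain ⟨t, hat, ht⟩ := h
  set S : Set ℝ := {t | a < t ∧ t ≤ b ∧ ∀ u, a < u → u < t → q u}
  have hne : min t b ∈ S := ⟨lt_min hat hab, min_le_right _ _,
    fun u hu hu' => ht u hu (hu'.trans_le (min_le_left _ _))⟩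
  have hbd : BddAbove S := ⟨b, fun x hx => hx.2.1⟩
  have hac : a < sSup S := hne.1.trans_le (le_csSup hbd hne)
  have hcb : sSup S ≤ b := csSup_le ⟨_, hne⟩ fun x hx => hx.2.1
  have hq : ∀ u, a < u → u < sSup S → q u := by
    intro u hu hu'
    obtain ⟨x, hx, hux⟩ := exists_lt_of_lt_csSup ⟨_, hne⟩ hu'
    exact hx.2.2 u hu hux
  rcases hcb.eq_or_lt with hcb | hcb
  · exact Or.inr (hcb ▸ hq)
  refine Or.inl ⟨sSup S, hac, hcb, hq, ?_⟩
  by_contra! hcon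
  obtain ⟨hc, e, hce, he⟩ := hcon
  have : min e b ∈ S := by
    refine ⟨hac.trans (lt_min hce hcb), min_le_right _ _, fun u hu hu' => ?_⟩
    rcases lt_trichotomy u (sSup S) with h | rfl | h
    exacts [hq u hu h, hc, he u h (hu'.trans_le (min_le_left _ _))]
  exact (lt_min hce hcb).not_ge (le_csSup hbd this)

/-- A property of reals on `(a, b)` either fails arbitrarily closely to the left of `b`, or has a
last point of failure inside `(a, b)`, or holds throughout. -/
lemma last_failure (q : ℝ → Prop) {a b : ℝ} (hab : a < b) :
    (¬ ∃ t, t < b ∧ ∀ u, t < u → u < b → q u) ∨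
    (∃ c, a < c ∧ c < b ∧ (∀ u, c < u → u < b → q u) ∧
      (¬ q c ∨ ¬ ∃ t, t < c ∧ ∀ u, t < u → u < c → q u)) ∨
    ∀ u, a < u → u < b → q u := by
  have key : ∀ s t : ℝ, (∀ u, -t < u → u < -s → q (-u)) ↔ ∀ u, s < u → u < t → q u := fun s t =>
    ⟨fun h u hu hu' => by simpa using h (-u) (by linarith) (by linarith),
      fun h u hu hu' => h (-u) (by linarith) (by linarith)⟩
  have ex : ∀ t : ℝ, (∃ s, -t < s ∧ ∀ u, -t < u → u < s → q (-u)) ↔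
      ∃ s, s < t ∧ ∀ u, s < u → u < t → q u := fun t =>
    ⟨fun ⟨s, hs, h⟩ => ⟨-s, by linarith, (key _ _).1 (by simpa using h)⟩,
      fun ⟨s, hs, h⟩ => ⟨-s, by linarith, (key _ _).2 h⟩⟩
  rcases first_failure (fun u => q (-u)) (neg_lt_neg hab) with h | ⟨c, hc, hc', h, h'⟩ | h
  · exact Or.inl (by rwa [ex] at h)
  · obtain ⟨c, rfl⟩ : ∃ d, c = -d := ⟨-c, by simp⟩
    refine Or.inr (Or.inl ⟨c, by linarith, by linarith, (key _ _).1 h, ?_⟩)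
    rwa [ex, neg_neg] at h'
  · exact Or.inr (Or.inr ((key _ _).1 h))

/-- Relations between the endpoints of a nonempty open interval that are definable by a finite
disjunction of decomposition formulas over `MTL_K`, up to equivalence on pairs `a < b`. -/
inductive SegDef (K : AddSubgroup ℝ) {P : Type} : ((ℝ → Set P) → ℝ → ℝ → Prop) → Prop
  | all (q : MTL K P) : SegDef K fun f a b => HoldsOn f q a b
  | left {R} (p : MTL K P) : SegDef K R → SegDef K fun f a b => p.sat f a ∧ R f a b
  | right {R} (p : MTL K P) : SegDef K R → SegDef K fun f a b => R f a b ∧ p.sat f b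
  | or {R S} : SegDef K R → SegDef K S → SegDef K fun f a b => R f a b ∨ S f a b
  | comp {R S} (p : MTL K P) : SegDef K R → SegDef K S →
      SegDef K fun f a b => ∃ c, a < c ∧ c < b ∧ R f a c ∧ p.sat f c ∧ S f c b
  | congr {R S} : SegDef K R → (∀ f a b, a < b → (R f a b ↔ S f a b)) → SegDef K S

/-- Relations on triples `a < c < b` which are finite unions of products of a relation in
`SegDef` on `(a, c)`, an `MTL_K` formula at `c`, and a relation in `SegDef` on `(c, b)`. -/
inductive CutDef (K : AddSubgroup ℝ) {P : Type} : ((ℝ → Set P) → ℝ → ℝ → ℝ → Prop) → Prop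
  | prod {R S} (p : MTL K P) : SegDef K R → SegDef K S →
      CutDef K fun f a c b => R f a c ∧ p.sat f c ∧ S f c b
  | or {T U} : CutDef K T → CutDef K U → CutDef K fun f a c b => T f a c b ∨ U f a c b
  | congr {T U} : CutDef K T → (∀ f a c b, a < c → c < b → (T f a c b ↔ U f a c b)) → CutDef K U

namespace CutDef

lemma guardLeft {T : (ℝ → Set P) → ℝ → ℝ → ℝ → Prop} (p : MTL K P) (h : CutDef K T) :
    CutDef K fun f a c b => p.sat f a ∧ T f a c b := by
  induction h with
  | prod p' hR hS => exact (prod p' (hR.left p) hS).congr fun f a c b _ _ => and_assoc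
  | or _ _ ih ih' => exact (ih.or ih').congr fun f a c b _ _ => and_or_left.symm
  | congr _ h ih => exact ih.congr fun f a c b h1 h2 => and_congr_right fun _ => h f a c b h1 h2

lemma guardRight {T : (ℝ → Set P) → ℝ → ℝ → ℝ → Prop} (p : MTL K P) (h : CutDef K T) :
    CutDef K fun f a c b => T f a c b ∧ p.sat f b := by
  induction h with
  | prod p' hR hS => exact (prod p' hR (hS.right p)).congr fun f a c b _ _ => by tauto
  | or _ _ ih ih' => exact (ih.or ih').congr fun f a c b _ _ => or_and_right.symm
  | congr _ h ih => exact ih.congr fun f a c b h1 h2 => and_congr_left fun _ => h f a c b h1 h2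

end CutDef

namespace SegDef

lemma true : SegDef K fun (_ : ℝ → Set P) _ _ => True :=
  (all .tt).congr fun _ _ _ _ => by simp

lemma false : SegDef K fun (_ : ℝ → Set P) _ _ => False :=
  (left .ff true).congr fun _ _ _ _ => by simp

lemma leftSat (p : MTL K P) : SegDef K fun f a _ => p.sat f a :=
  (left p true).congr fun _ _ _ _ => by simp

lemma rightSat (p : MTL K P) : SegDef K fun f _ b => p.sat f b :=
  (right p true).congr fun _ _ _ _ => by simp

lemma ofCut {T : (ℝ → Set P) → ℝ → ℝ → ℝ → Prop} (h : CutDef K T) :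
    SegDef K fun f a b => ∃ c, a < c ∧ c < b ∧ T f a c b := by
  induction h with
  | prod p hR hS => exact comp p hR hS
  | or _ _ ih ih' =>
    exact (or ih ih').congr fun f a b _ => by simp only [← exists_or, ← and_or_left]
  | congr _ h ih =>
    exact ih.congr fun f a b _ => exists_congr fun c => and_congr_right fun h1 =>
      and_congr_right fun h2 => h f a c b h1 h2

/-- A relation in `SegDef` can be evaluated by cutting the interval at an intermediate point. -/
lemma cut {R : (ℝ → Set P) → ℝ → ℝ → Prop} (h : SegDef K R) :
    CutDef K fun f a _ b => R f a b := by
  induction h with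
  | all q => exact (CutDef.prod q (all q) (all q)).congr fun f a c b h1 h2 =>
      (holdsOn_split h1 h2).symm
  | left p _ ih => exact ih.guardLeft p
  | right p _ ih => exact ih.guardRight p
  | or _ _ ih ih' => exact ih.or ih'
  | congr _ h ih => exact ih.congr fun f a c b h1 h2 => h f a b (h1.trans h2)
  | @comp R S p hR hS ih ih' =>
    have h1 : CutDef K fun f a c b => ∃ d, c < d ∧ d < b ∧ R f a d ∧ p.sat f d ∧ S f d b := by
      clear ih'
      have key : ∀ {T : (ℝ → Set P) → ℝ → ℝ → ℝ → Prop}, CutDef K T →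
          CutDef K fun f a c b => ∃ d, c < d ∧ d < b ∧ T f a c d ∧ p.sat f d ∧ S f d b := by
        intro T hT
        induction hT with
        | prod p' h h' =>
          refine (CutDef.prod p' h (comp p h' hS)).congr fun f a c b _ _ => ?_
          constructor
          · rintro ⟨x, y, d, h1, h2, h3, h4⟩; exact ⟨d, h1, h2, ⟨x, y, h3⟩, h4⟩
          · rintro ⟨d, h1, h2, ⟨x, y, h3⟩, h4⟩; exact ⟨x, y, d, h1, h2, h3, h4⟩
        | or _ _ ih ih' =>
          refine (ih.or ih').congr fun f a c b _ _ => ?_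
          simp only [← exists_or, ← and_or_left, ← or_and_right]
        | congr _ h ih =>
          refine ih.congr fun f a c b h1 _ => exists_congr fun d => and_congr_right fun h3 =>
            and_congr_right fun _ => and_congr_left fun _ => h f a c d h1 h3
      exact key ih
    have h2 : CutDef K fun f a c b => ∃ d, a < d ∧ d < c ∧ R f a d ∧ p.sat f d ∧ S f d b := by
      have key : ∀ {T : (ℝ → Set P) → ℝ → ℝ → ℝ → Prop}, CutDef K T →
          CutDef K fun f a c b => ∃ d, a < d ∧ d < c ∧ R f a d ∧ p.sat f d ∧ T f d c b := by
        intro T hT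
        induction hT with
        | prod p' h h' =>
          refine (CutDef.prod p' (comp p hR h) h').congr fun f a c b _ _ => ?_
          constructor
          · rintro ⟨⟨d, h1, h2, h3, h4, h5⟩, x, y⟩; exact ⟨d, h1, h2, h3, h4, h5, x, y⟩
          · rintro ⟨d, h1, h2, h3, h4, h5, x, y⟩; exact ⟨⟨d, h1, h2, h3, h4, h5⟩, x, y⟩
        | or _ _ ih ih' =>
          refine (ih.or ih').congr fun f a c b _ _ => ?_
          simp only [← exists_or, ← and_or_left]
        | congr _ h ih =>
          refine ih.congr fun f a c b _ h2 => exists_congr fun d => and_congr_right fun _ =>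
            and_congr_right fun h4 => and_congr_right fun _ => and_congr_right fun _ =>
              h f d c b h4 h2
      exact key ih'
    refine (h1.or (h2.or (CutDef.prod p hR hS))).congr fun f a c b hac hcb => ?_
    constructor
    · rintro (⟨d, h1, h2, h⟩ | ⟨d, h1, h2, h⟩ | h)
      exacts [⟨d, hac.trans h1, h2, h⟩, ⟨d, h1, h2.trans hcb, h⟩, ⟨c, hac, hcb, h⟩]
    · rintro ⟨d, h1, h2, h⟩
      rcases lt_trichotomy c d with h' | rfl | h'
      exacts [Or.inl ⟨d, h', h2, h⟩, Or.inr (Or.inr h), Or.inr (Or.inl ⟨d, h1, h', h⟩)]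

lemma all_and {R : (ℝ → Set P) → ℝ → ℝ → Prop} (q : MTL K P) (hR : SegDef K R) :
    SegDef K fun f a b => HoldsOn f q a b ∧ R f a b := by
  induction hR with
  | all q' => exact (all (q.conj q')).congr fun _ _ _ _ => holdsOn_conj
  | left p _ ih => exact (ih.left p).congr fun _ _ _ _ => and_left_comm
  | right p _ ih => exact (ih.right p).congr fun _ _ _ _ => and_assoc
  | or _ _ ih ih' => exact (ih.or ih').congr fun _ _ _ _ => and_or_left.symm
  | comp p _ _ ih ih' =>
    refine (ih.comp (p.conj q) ih').congr fun f a b _ => ?_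
    rw [← exists_and_left]
    refine exists_congr fun c => ?_
    rw [MTL.sat_conj]
    constructor
    · rintro ⟨h1, h2, ⟨h3, h4⟩, ⟨h5, h6⟩, h7, h8⟩
      exact ⟨(holdsOn_split h1 h2).2 ⟨h3, h6, h7⟩, h1, h2, h4, h5, h8⟩
    · rintro ⟨h, h1, h2, h4, h5, h8⟩
      obtain ⟨h3, h6, h7⟩ := (holdsOn_split h1 h2).1 h
      exact ⟨h1, h2, ⟨h3, h4⟩, ⟨h5, h6⟩, h7, h8⟩
  | congr _ h ih => exact ih.congr fun f a b hab => and_congr_right fun _ => h f a b hab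

lemma and {R S : (ℝ → Set P) → ℝ → ℝ → Prop} (hR : SegDef K R) (hS : SegDef K S) :
    SegDef K fun f a b => R f a b ∧ S f a b := by
  induction hR generalizing S with
  | all q => exact hS.all_and q
  | left p _ ih => exact ((ih hS).left p).congr fun _ _ _ _ => and_assoc.symm
  | right p _ ih => exact ((ih hS).right p).congr fun _ _ _ _ => by tauto
  | or _ _ ih ih' => exact ((ih hS).or (ih' hS)).congr fun _ _ _ _ => or_and_right.symm
  | congr _ h ih => exact (ih hS).congr fun f a b hab => and_congr_left fun _ => h f a b hab
  | @comp R R' p _ _ ih ih' =>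
    have key : ∀ {T : (ℝ → Set P) → ℝ → ℝ → ℝ → Prop}, CutDef K T →
        CutDef K fun f a c b => (R f a c ∧ p.sat f c ∧ R' f c b) ∧ T f a c b := by
      intro T hT
      induction hT with
      | prod p' h h' =>
        exact (CutDef.prod (p.conj p') (ih h) (ih' h')).congr fun f a c b _ _ => by
          rw [MTL.sat_conj]; tauto
      | or _ _ ih ih' => exact (ih.or ih').congr fun _ _ _ _ _ _ => and_or_left.symm
      | congr _ h ih =>
        exact ih.congr fun f a c b h1 h2 => and_congr_right fun _ => h f a c b h1 h2
    refine (ofCut (key hS.cut)).congr fun f a b _ => ?_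
    rw [← exists_and_right]
    exact exists_congr fun c => by tauto

end SegDef

lemma CutDef.and {T U : (ℝ → Set P) → ℝ → ℝ → ℝ → Prop} (hT : CutDef K T) (hU : CutDef K U) :
    CutDef K fun f a c b => T f a c b ∧ U f a c b := by
  induction hT generalizing U with
  | or _ _ ih ih' => exact ((ih hU).or (ih' hU)).congr fun _ _ _ _ _ _ => or_and_right.symm
  | congr _ h ih =>
    exact (ih hU).congr fun f a c b h1 h2 => and_congr_left fun _ => h f a c b h1 h2
  | prod p hR hS =>
    induction hU with
    | prod p' hR' hS' =>
      exact (CutDef.prod (p.conj p') (hR.and hR') (hS.and hS')).congr fun f a c b _ _ => by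
        rw [MTL.sat_conj]; tauto
    | or _ _ ih ih' => exact (ih.or ih').congr fun _ _ _ _ _ _ => and_or_left.symm
    | congr _ h ih =>
      exact ih.congr fun f a c b h1 h2 => and_congr_right fun _ => h f a c b h1 h2

/-- A decomposition formula: the interval `(a, b)` is divided by points satisfying the second
components of the list, with the first components (and finally `q`) holding in between. -/
def Chain (f : ℝ → Set P) : List (MTL K P × MTL K P) → MTL K P → ℝ → ℝ → Prop
  | [], q, a, b => HoldsOn f q a b
  | (q', p) :: l, q, a, b => ∃ c, a < c ∧ c < b ∧ HoldsOn f q' a c ∧ p.sat f c ∧ Chain f l q c b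

/-- The ways of cutting a decomposition formula at an intermediate point. -/
def cuts : List (MTL K P × MTL K P) → MTL K P →
    List ((List (MTL K P × MTL K P) × MTL K P) × MTL K P × (List (MTL K P × MTL K P) × MTL K P))
  | [], q => [(([], q), q, ([], q))]
  | (q', p) :: l, q => (([], q'), q', ((q', p) :: l, q)) :: (([], q'), p, (l, q)) ::
      (cuts l q).map fun s => (((q', p) :: s.1.1, s.1.2), s.2)

lemma chain_cut {f : ℝ → Set P} {l : List (MTL K P × MTL K P)} {q : MTL K P} {a b c : ℝ}
    (hac : a < c) (hcb : c < b) : Chain f l q a b ↔ ∃ s ∈ cuts l q,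
      Chain f s.1.1 s.1.2 a c ∧ s.2.1.sat f c ∧ Chain f s.2.2.1 s.2.2.2 c b := by
  induction l generalizing a with
  | nil => simpa [cuts, Chain] using holdsOn_split hac hcb
  | cons x l ih =>
    obtain ⟨q', p⟩ := x
    simp only [cuts, List.mem_cons, List.mem_map, exists_eq_or_imp, exists_exists_and_eq_and]
    constructor
    · rintro ⟨d, h1, h2, h3, h4, h5⟩
      rcases lt_trichotomy c d with h | rfl | h
      · exact Or.inl ⟨h3.mono le_rfl h.le, h3 c hac h, d, h, h2, h3.mono hac.le le_rfl, h4, h5⟩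
      · exact Or.inr (Or.inl ⟨h3, h4, h5⟩)
      · obtain ⟨s, hs, h6, h7⟩ := (ih h).1 h5
        exact Or.inr (Or.inr ⟨s, hs, ⟨d, h1, h, h3, h4, h6⟩, h7⟩)
    · rintro (⟨h1, h2, d, h3, h4, h5, h6⟩ | ⟨h1, h2, h3⟩ | ⟨s, hs, ⟨d, h1, h2, h3, h4, h5⟩, h6⟩)
      · exact ⟨d, hac.trans h3, h4, (holdsOn_split hac h3).2 ⟨h1, h2, h5⟩, h6⟩
      · exact ⟨c, hac, hcb, h1, h2, h3⟩
      · exact ⟨d, h1, h2.trans hcb, h3, h4, (ih h2).2 ⟨s, hs, h5, h6⟩⟩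

lemma length_left_of_mem_cuts {l : List (MTL K P × MTL K P)} {q : MTL K P} {s}
    (hs : s ∈ cuts l q) : s.1.1.length < l.length ∨ s = ((l, q), q, ([], q)) := by
  induction l generalizing s with
  | nil => exact Or.inr (by simpa [cuts] using hs)
  | cons x l ih =>
    simp only [cuts, List.mem_cons, List.mem_map] at hs
    rcases hs with rfl | rfl | ⟨s, hs, rfl⟩
    · simp
    · simp
    · rcases ih hs with h | rfl
      · exact Or.inl (by simpa using h)
      · exact Or.inr rfl

lemma length_right_le_of_mem_cuts {l : List (MTL K P × MTL K P)} {q : MTL K P} {s}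
    (hs : s ∈ cuts l q) : s.2.2.1.length ≤ l.length := by
  induction l generalizing s with
  | nil => simp_all [cuts]
  | cons x l ih =>
    simp only [cuts, List.mem_cons, List.mem_map] at hs
    rcases hs with rfl | rfl | ⟨s, hs, rfl⟩
    · simp
    · simp
    · exact (ih hs).trans (by simp)

lemma length_right_of_mem_cuts {l : List (MTL K P × MTL K P)} {q q' p : MTL K P} {s}
    (hs : s ∈ cuts ((q', p) :: l) q) :
    s.2.2.1.length < ((q', p) :: l).length ∨ s = (([], q'), q', ((q', p) :: l, q)) := by
  simp only [cuts, List.mem_cons, List.mem_map] at hs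
  rcases hs with rfl | rfl | ⟨s, hs, rfl⟩
  · exact Or.inr rfl
  · exact Or.inl (by simp)
  · exact Or.inl ((length_right_le_of_mem_cuts hs).trans_lt (by simp))

lemma chain_append {f : ℝ → Set P} {l l' : List (MTL K P × MTL K P)} {q q' p : MTL K P} {a b : ℝ} :
    Chain f (l ++ (q, p) :: l') q' a b ↔
      ∃ c, a < c ∧ c < b ∧ Chain f l q a c ∧ p.sat f c ∧ Chain f l' q' c b := by
  induction l generalizing a with
  | nil => rfl
  | cons x l ih =>
    simp only [List.cons_append, Chain, ih]
    constructor
    · rintro ⟨d, h1, h2, h3, h4, c, h5, h6, h7, h8, h9⟩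
      exact ⟨c, h1.trans h5, h6, ⟨d, h1, h5, h3, h4, h7⟩, h8, h9⟩
    · rintro ⟨c, h1, h2, ⟨d, h3, h4, h5, h6, h7⟩, h8, h9⟩
      exact ⟨d, h3, h4.trans h2, h5, h6, c, h4, h2, h7, h8, h9⟩

/-- The final segment of a decomposition. -/
lemma Chain.exists_holdsOn_left {f : ℝ → Set P} {l : List (MTL K P × MTL K P)} {q : MTL K P}
    {a b : ℝ} (hab : a < b) (h : Chain f l q a b) : ∃ c, a ≤ c ∧ c < b ∧ HoldsOn f q c b := by
  induction l generalizing a with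
  | nil => exact ⟨a, le_rfl, hab, h⟩
  | cons x l ih =>
    obtain ⟨d, h1, h2, -, -, h5⟩ := h
    obtain ⟨c, h6, h7⟩ := ih h2 h5
    exact ⟨c, h1.le.trans h6, h7⟩

lemma Chain.holdsOn_cons {f : ℝ → Set P} {l : List (MTL K P × MTL K P)} {q q' p : MTL K P}
    {a b : ℝ} (h : Chain f ((q', p) :: l) q a b) : ∃ c, a < c ∧ HoldsOn f q' a c :=
  let ⟨c, h1, _, h3, _⟩ := h; ⟨c, h1, h3⟩

/-- There is an increasing sequence of points in `(a, b)` satisfying the given formulas. -/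
def Incr (f : ℝ → Set P) : List (MTL K P) → ℝ → ℝ → Prop
  | [], _, _ => True
  | p :: l, a, b => ∃ c, a < c ∧ c < b ∧ p.sat f c ∧ Incr f l c b

lemma Incr.mono {f : ℝ → Set P} {l : List (MTL K P)} {a a' b : ℝ} (h : Incr f l a b)
    (ha : a' ≤ a) : Incr f l a' b := by
  cases l with
  | nil => trivial
  | cons p l =>
    obtain ⟨c, h1, h2⟩ := h
    exact ⟨c, ha.trans_lt h1, h2⟩

lemma segDef_not_incr (l : List (MTL K P)) : SegDef K fun f a b => ¬ Incr f l a b := by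
  induction l with
  | nil => exact SegDef.false.congr fun _ _ _ _ => by simp [Incr]
  | cons p l ih =>
    have h1 := ih.left p.neg.gapR
    have h2 := (SegDef.all p.neg).comp (p.disj p.neg.gapR) ih
    refine (h1.or (h2.or (.all p.neg))).congr fun f a b hab => ?_
    simp only [MTL.sat_gapR, MTL.sat_disj]
    constructor
    · rintro (⟨-, h2⟩ | ⟨c, h1, h2, h3, -, h5⟩ | h) ⟨d, h6, h7, h8, h9⟩
      · exact h2 (h9.mono h6.le)
      · exact h5 (h9.mono (le_of_not_gt fun hdc => h3 d h6 hdc h8))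
      · exact h d h6 h7 h8
    · intro h
      have nolim : ∀ c, a ≤ c → c < b → Incr f l c b → ∃ t, c < t ∧ HoldsOn f p.neg c t := by
        intro c hac hcb hI
        cases l with
        | nil => exact ⟨b, hcb, fun u hu hu' hp => h ⟨u, hac.trans_lt hu, hu', hp, trivial⟩⟩
        | cons p' l =>
          obtain ⟨d, hcd, hdb, hd⟩ := hI
          exact ⟨d, hcd, fun u hu hu' hp =>
            h ⟨u, hac.trans_lt hu, hu'.trans hdb, hp, d, hu', hdb, hd⟩⟩
      rcases first_failure (fun u => p.neg.sat f u) hab with h' | ⟨c, h1, h2, h3, h4⟩ | hp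
      · exact Or.inl ⟨h', fun hI => h' (nolim a le_rfl hab hI)⟩
      · refine Or.inr (Or.inl ⟨c, h1, h2, h3, h4.imp_left not_not.1, fun hI => ?_⟩)
        rcases h4 with h4 | h4
        · exact h ⟨c, h1, h2, not_not.1 h4, hI⟩
        · exact h4 (nolim c h1.le h2 hI)
      · exact Or.inr (Or.inr hp)

/-- `p` holds and a decomposition along the list starts here. -/
def fwdHead (p : MTL K P) : List (MTL K P × MTL K P) → MTL K P
  | [] => p
  | (q, p') :: l => .conj p (.untl q (fwdHead p' l) .full)

/-- The formulas `fwdHead` at the successive points of a decomposition. -/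
def fwdHeads : List (MTL K P × MTL K P) → List (MTL K P)
  | [] => []
  | (_, p) :: l => fwdHead p l :: fwdHeads l

/-- A decomposition whose last segment is unconstrained amounts to an increasing sequence. -/
lemma chain_tt_iff {f : ℝ → Set P} {p q : MTL K P} {l : List (MTL K P × MTL K P)} {c b : ℝ}
    (hq : HoldsOn f q c b) : p.sat f c ∧ Chain f l q c b ↔
      (fwdHead p l).sat f c ∧ Incr f (fwdHeads l) c b := by
  induction l generalizing p c with
  | nil => simp [Chain, Incr, fwdHead, fwdHeads, hq]
  | cons x l ih =>
    obtain ⟨q', p'⟩ := x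
    simp only [fwdHead, fwdHeads, MTL.sat_conj, MTL.sat_untl, MTLI.mem_full, sub_pos, Incr, Chain]
    constructor
    · rintro ⟨h, d, h1, h2, h3, h4⟩
      have := (ih (hq.mono h1.le le_rfl)).1 h4
      exact ⟨⟨h, d, h1, h1, this.1, h3⟩, d, h1, h2, this⟩
    · rintro ⟨⟨h, d, h1, -, h2, h3⟩, e, h4, h5, h6, h7⟩
      refine ⟨h, ?_⟩
      rcases le_total d e with hde | hed
      · exact ⟨d, h1, hde.trans_lt h5, h3,
          (ih (hq.mono h1.le le_rfl)).2 ⟨h2, h7.mono hde⟩⟩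
      · exact ⟨e, h4, h5, h3.mono le_rfl hed, (ih (hq.mono h4.le le_rfl)).2 ⟨h6, h7⟩⟩

lemma cutDef_not_prod {R S G H : (ℝ → Set P) → ℝ → ℝ → Prop} (g r : MTL K P)
    (hG : SegDef K G) (hH : SegDef K H)
    (hR : SegDef K fun f a b => G f a b ∧ ¬ R f a b)
    (hS : SegDef K fun f a b => H f a b ∧ ¬ S f a b) :
    CutDef K fun f a c b => (G f a c ∧ g.sat f c ∧ H f c b) ∧
      ¬ (R f a c ∧ r.sat f c ∧ S f c b) := by
  refine ((CutDef.prod g hR hH).or ((CutDef.prod (g.conj r.neg) hG hH).or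
    (CutDef.prod g hG hS))).congr fun f a c b _ _ => ?_
  simp only [MTL.sat_conj, MTL.sat_neg]
  tauto

lemma CutDef.forall_list {ι : Type*} {B : (ℝ → Set P) → ℝ → ℝ → ℝ → Prop}
    {X : ι → (ℝ → Set P) → ℝ → ℝ → ℝ → Prop} (hB : CutDef K B) (L : List ι)
    (h : ∀ s ∈ L, CutDef K fun f a c b => B f a c b ∧ ¬ X s f a c b) :
    CutDef K fun f a c b => B f a c b ∧ ¬ ∃ s ∈ L, X s f a c b := by
  induction L with
  | nil => exact hB.congr fun _ _ _ _ _ _ => by simp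
  | cons s L ih =>
    refine ((h s (by simp)).and (ih fun s' hs' => h s' (by simp [hs']))).congr
      fun f a c b _ _ => ?_
    rw [List.exists_mem_cons_iff, not_or, ← and_and_left]

lemma segDef_not_chain (l : List (MTL K P × MTL K P)) (q : MTL K P) :
    SegDef K fun f a b => ¬ Chain f l q a b := by
  induction hn : l.length using Nat.strong_induction_on generalizing l q with
  | _ n ih =>
  subst hn
  have ih' : ∀ (l' : List (MTL K P × MTL K P)) (q' : MTL K P), l'.length < l.length →
      SegDef K fun f a b => ¬ Chain f l' q' a b := fun l' q' h => ih _ h l' q' rfl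
  clear ih
  rcases l with - | ⟨⟨q', p⟩, l⟩
  · refine ((SegDef.all .tt).comp q.neg (.all .tt)).congr fun f a b _ => ?_
    simp [Chain, HoldsOn]
  have both : SegDef K fun f a b => HoldsOn f (q'.conj q) a b ∧
      ¬ Chain f ((q', p) :: l) q a b := by
    refine ((segDef_not_incr (fwdHead p l :: fwdHeads l)).all_and (q'.conj q)).congr
      fun f a b _ => and_congr_right fun h => not_congr ?_
    rw [holdsOn_conj] at h
    simp only [Incr, Chain]
    refine exists_congr fun c => and_congr_right fun h1 => and_congr_right fun h2 => ?_
    rw [← chain_tt_iff (h.2.mono h1.le le_rfl)]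
    simp [h.1.mono le_rfl h2.le]
  have first : SegDef K fun f a b => HoldsOn f q' a b ∧ ¬ Chain f ((q', p) :: l) q a b := by
    have h1 := (SegDef.all q').right q.gapL
    have h2 : CutDef K fun f a c b =>
        (HoldsOn f q' a c ∧ (q'.conj (q.neg.disj q.gapL)).sat f c ∧ HoldsOn f (q'.conj q) c b) ∧
          ¬ ∃ s ∈ cuts ((q', p) :: l) q, Chain f s.1.1 s.1.2 a c ∧ s.2.1.sat f c ∧
            Chain f s.2.2.1 s.2.2.2 c b := by
      refine CutDef.forall_list (.prod _ (.all _) (.all _)) _ fun s hs => ?_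
      rcases length_left_of_mem_cuts hs with hl | rfl
      · refine cutDef_not_prod _ _ (.all _) (.all _) ((ih' _ _ hl).all_and _) ?_
        rcases length_right_of_mem_cuts hs with hr | rfl
        · exact (ih' _ _ hr).all_and _
        · exact both
      · refine (CutDef.prod (q'.conj (q.neg.disj q.gapL)) (.all q')
          (.all (q'.conj q))).congr fun f a c b hac _ => (and_iff_left_of_imp ?_).symm
        rintro ⟨-, ⟨-, h⟩, -⟩ ⟨h1, h2, -⟩
        obtain ⟨e, -, he⟩ := h1.exists_holdsOn_left hac
        rw [MTL.sat_disj, MTL.sat_gapL, MTL.sat_neg] at h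
        rcases h with h | h
        exacts [h h2, h ⟨e, he⟩]
    refine (h1.or ((SegDef.ofCut h2).or both)).congr fun f a b hab => ?_
    constructor
    · rintro (⟨h, h'⟩ | ⟨c, h1, h2, ⟨h3, ⟨h4, -⟩, h5⟩, h6⟩ | h)
      · refine ⟨h, fun hC => ?_⟩
        rw [MTL.sat_gapL] at h'
        obtain ⟨e, -, he⟩ := hC.exists_holdsOn_left hab
        exact h' ⟨e, he⟩
      · rw [holdsOn_conj] at h5
        exact ⟨(holdsOn_split h1 h2).2 ⟨h3, h4, h5.1⟩, by rwa [chain_cut h1 h2]⟩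
      · exact ⟨(holdsOn_conj.1 h.1).1, h.2⟩
    · rintro ⟨h, hC⟩
      rcases last_failure (fun u => q.sat f u) hab with h' | ⟨c, h1, h2, h3, h4⟩ | h'
      · exact Or.inl ⟨h, by rwa [MTL.sat_gapL]⟩
      · refine Or.inr (Or.inl ⟨c, h1, h2, ⟨h.mono le_rfl h2.le, ⟨h c h1 h2, ?_⟩,
          holdsOn_conj.2 ⟨h.mono h1.le le_rfl, h3⟩⟩, by rwa [← chain_cut h1 h2]⟩)
        rwa [MTL.sat_disj, MTL.sat_gapL, MTL.sat_neg]
      · exact Or.inr (Or.inr ⟨holdsOn_conj.2 ⟨h, h'⟩, hC⟩)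
  have h1 := SegDef.leftSat q'.gapR
  have h2 : CutDef K fun f a c b =>
      (HoldsOn f q' a c ∧ (q'.neg.disj q'.gapR).sat f c ∧ True) ∧
        ¬ ∃ s ∈ cuts ((q', p) :: l) q, Chain f s.1.1 s.1.2 a c ∧ s.2.1.sat f c ∧
          Chain f s.2.2.1 s.2.2.2 c b := by
    refine CutDef.forall_list (.prod _ (.all _) .true) _ fun s hs => ?_
    rcases length_right_of_mem_cuts hs with hr | rfl
    · refine cutDef_not_prod _ _ (.all _) .true ?_ (SegDef.true.and (ih' _ _ hr))
      rcases length_left_of_mem_cuts hs with hl | rfl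
      · exact (ih' _ _ hl).all_and _
      · exact first
    · refine (CutDef.prod (q'.neg.disj q'.gapR) (.all q') .true).congr
        fun f a c b _ hcb => (and_iff_left_of_imp ?_).symm
      rintro ⟨-, h, -⟩ ⟨-, h2, h3⟩
      rw [MTL.sat_disj, MTL.sat_gapR, MTL.sat_neg] at h
      rcases h with h | h
      exacts [h h2, h h3.holdsOn_cons]
  refine (h1.or ((SegDef.ofCut h2).or first)).congr fun f a b hab => ?_
  constructor
  · rintro (h | ⟨c, h1, h2, -, h6⟩ | h) hC
    · rw [MTL.sat_gapR] at h
      exact h hC.holdsOn_cons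
    · exact h6 ((chain_cut h1 h2).1 hC)
    · exact h.2 hC
  · intro hC
    rcases first_failure (fun u => q'.sat f u) hab with h' | ⟨c, h1, h2, h3, h4⟩ | hq
    · exact Or.inl (by rwa [MTL.sat_gapR])
    · refine Or.inr (Or.inl ⟨c, h1, h2, ⟨h3, ?_, trivial⟩, by rwa [← chain_cut h1 h2]⟩)
      rwa [MTL.sat_disj, MTL.sat_gapR, MTL.sat_neg]
    · exact Or.inr (Or.inr ⟨hq, hC⟩)

/-- Finite unions of decomposition formulas with constraints at the endpoints. -/
inductive ChainDef (K : AddSubgroup ℝ) {P : Type} : ((ℝ → Set P) → ℝ → ℝ → Prop) → Prop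
  | chain (p : MTL K P) (l : List (MTL K P × MTL K P)) (q p' : MTL K P) :
      ChainDef K fun f a b => p.sat f a ∧ Chain f l q a b ∧ p'.sat f b
  | or {R S} : ChainDef K R → ChainDef K S → ChainDef K fun f a b => R f a b ∨ S f a b
  | congr {R S} : ChainDef K R → (∀ f a b, a < b → (R f a b ↔ S f a b)) → ChainDef K S

lemma SegDef.chainDef {R : (ℝ → Set P) → ℝ → ℝ → Prop} (h : SegDef K R) : ChainDef K R := by
  induction h with
  | all q => exact (ChainDef.chain .tt [] q .tt).congr fun _ _ _ _ => by simp [Chain]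
  | or _ _ ih ih' => exact ih.or ih'
  | congr _ h ih => exact ih.congr h
  | left p _ ih =>
    clear * - ih
    induction ih with
    | chain p' l q p'' =>
      exact (ChainDef.chain (p.conj p') l q p'').congr fun _ _ _ _ => by
        rw [MTL.sat_conj, and_assoc]
    | or _ _ ih ih' => exact (ih.or ih').congr fun _ _ _ _ => and_or_left.symm
    | congr _ h ih => exact ih.congr fun f a b hab => and_congr_right fun _ => h f a b hab
  | right p _ ih =>
    clear * - ih
    induction ih with
    | chain p' l q p'' =>
      exact (ChainDef.chain p' l q (p''.conj p)).congr fun _ _ _ _ => by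
        rw [MTL.sat_conj]; tauto
    | or _ _ ih ih' => exact (ih.or ih').congr fun _ _ _ _ => or_and_right.symm
    | congr _ h ih => exact ih.congr fun f a b hab => and_congr_left fun _ => h f a b hab
  | comp p _ _ ih ih' =>
    clear * - ih ih'
    induction ih with
    | or _ _ ih ih' =>
      exact (ih.or ih').congr fun _ _ _ _ => by
        simp only [← exists_or, ← and_or_left, ← or_and_right]
    | congr _ h ih =>
      exact ih.congr fun f a b _ => exists_congr fun c => and_congr_right fun h1 =>
        and_congr_right fun _ => and_congr_left fun _ => h f a c h1
    | chain p₁ l₁ q₁ p₁' =>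
      induction ih' with
      | or _ _ ih ih' =>
        exact (ih.or ih').congr fun _ _ _ _ => by
          simp only [← exists_or, ← and_or_left]
      | congr _ h ih =>
        exact ih.congr fun f a b _ => exists_congr fun c => and_congr_right fun _ =>
          and_congr_right fun h2 => and_congr_right fun _ => and_congr_right fun _ => h f c b h2
      | chain p₂ l₂ q₂ p₂' =>
        refine (ChainDef.chain p₁ (l₁ ++ (q₁, p₁'.conj (p.conj p₂)) :: l₂) q₂ p₂').congr
          fun f a b _ => ?_
        rw [chain_append]
        simp only [MTL.sat_conj]
        constructor
        · rintro ⟨x, ⟨c, h1, h2, h3, h4, h5⟩, y⟩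
          exact ⟨c, h1, h2, ⟨x, h3, h4.1⟩, h4.2.1, h4.2.2, h5, y⟩
        · rintro ⟨c, h1, h2, ⟨x, h3, h4⟩, h5, h6, h7, y⟩
          exact ⟨x, ⟨c, h1, h2, h3, ⟨h4, h5, h6⟩, h7⟩, y⟩

/-- Complementation, in the spirit of Rabinovich's proof of Kamp's theorem. -/
lemma SegDef.not {R : (ℝ → Set P) → ℝ → ℝ → Prop} (h : SegDef K R) :
    SegDef K fun f a b => ¬ R f a b := by
  replace h := h.chainDef
  induction h with
  | chain p l q p' =>
    refine ((SegDef.leftSat p.neg).or ((segDef_not_chain l q).or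
      (SegDef.rightSat p'.neg))).congr fun f a b _ => ?_
    simp only [MTL.sat_neg]
    tauto
  | or _ _ ih ih' => exact (ih.and ih').congr fun _ _ _ _ => not_or.symm
  | congr _ h ih => exact ih.congr fun f a b hab => not_congr (h f a b hab)

lemma SegDef.shift {R : (ℝ → Set P) → ℝ → ℝ → Prop} (h : SegDef K R) (c : K) :
    SegDef K fun f a b => R f (a + c) (b + c) := by
  induction h with
  | all q =>
    refine (SegDef.all (q.shift c)).congr fun f a b _ => ?_
    simp only [HoldsOn, MTL.sat_shift]
    exact ⟨fun h u hu hu' => by simpa using h (u - c) (by linarith) (by linarith),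
      fun h u hu hu' => h _ (by linarith) (by linarith)⟩
  | left p _ ih => exact (ih.left (p.shift c)).congr fun f a b _ => by simp
  | right p _ ih => exact (ih.right (p.shift c)).congr fun f a b _ => by simp
  | or _ _ ih ih' => exact ih.or ih'
  | congr _ h ih => exact ih.congr fun f a b hab => h f _ _ (by linarith)
  | comp p _ _ ih ih' =>
    refine (ih.comp (p.shift c) ih').congr fun f a b _ => ?_
    simp only [MTL.sat_shift]
    constructor
    · rintro ⟨d, h1, h2, h3⟩
      exact ⟨d + c, by linarith, by linarith, h3⟩
    · rintro ⟨d, h1, h2, h3⟩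
      exact ⟨d - c, by linarith, by linarith, by simpa using h3⟩

/-- Nested until operators: a decomposition starts here and ends at a point satisfying `p`. -/
def fwd (I : MTLI K) : List (MTL K P × MTL K P) → MTL K P → MTL K P → MTL K P
  | [], q, p => .untl q p I
  | (q', p') :: l, q, p => .untl q' (.conj p' (fwd I l q p)) I

/-- Nested since operators: a decomposition ends here and starts at a point satisfying `p`. -/
def bwd (I : MTLI K) : MTL K P → List (MTL K P × MTL K P) → MTL K P → MTL K P
  | p, [], q => .sinc q p I
  | p, (q', p') :: l, q => bwd I (.conj p' (.sinc q' p I)) l q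

lemma exists_chain_of_fwd {I : MTLI K} {f : ℝ → Set P} {l : List (MTL K P × MTL K P)}
    {q p : MTL K P} {x : ℝ} (h : (fwd I l q p).sat f x) : ∃ y, x < y ∧ Chain f l q x y ∧
      p.sat f y ∧ ∀ e, (∀ t, I.mem t → t ≤ e) → y ≤ x + (l.length + 1) * e := by
  induction l generalizing x with
  | nil =>
    obtain ⟨y, h1, h2, h3, h4⟩ := h
    exact ⟨y, h1, h4, h3, fun e he => by simpa [add_comm] using he _ h2⟩
  | cons s l ih =>
    obtain ⟨q', p'⟩ := s
    obtain ⟨c, h1, h2, ⟨h3, h4⟩, h5⟩ := h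
    obtain ⟨y, h6, h7, h8, h9⟩ := ih h4
    refine ⟨y, h1.trans h6, ⟨c, h1, h6, h5, h3, h7⟩, h8, fun e he => ?_⟩
    have := h9 e he
    have := he _ h2
    rw [List.length_cons]
    push_cast
    linarith

lemma fwd_of_chain {I : MTLI K} {f : ℝ → Set P} {l : List (MTL K P × MTL K P)} {q p : MTL K P}
    {x y : ℝ} (hxy : x < y) (hI : ∀ t, 0 < t → t ≤ y - x → I.mem t) (h : Chain f l q x y)
    (hp : p.sat f y) : (fwd I l q p).sat f x := by
  induction l generalizing x with
  | nil => exact ⟨y, hxy, hI _ (sub_pos.2 hxy) le_rfl, hp, h⟩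
  | cons s l ih =>
    obtain ⟨c, h1, h2, h3, h4, h5⟩ := h
    exact ⟨c, h1, hI _ (sub_pos.2 h1) (by linarith),
      ⟨h4, ih h2 (fun t ht ht' => hI t ht (by linarith)) h5⟩, h3⟩

lemma exists_chain_of_bwd {I : MTLI K} {f : ℝ → Set P} {l : List (MTL K P × MTL K P)}
    {q p : MTL K P} {y : ℝ} (h : (bwd I p l q).sat f y) : ∃ x, x < y ∧ Chain f l q x y ∧
      p.sat f x ∧ ∀ e, (∀ t, I.mem t → t ≤ e) → y ≤ x + (l.length + 1) * e := by
  induction l generalizing p with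
  | nil =>
    obtain ⟨x, h1, h2, h3, h4⟩ := h
    refine ⟨x, h1, h4, h3, fun e he => ?_⟩
    have := he _ h2
    simp only [List.length_nil, Nat.cast_zero]
    linarith
  | cons s l ih =>
    obtain ⟨q', p'⟩ := s
    obtain ⟨c, h6, h7, ⟨h3, x, h1, h2, h4, h5⟩, h9⟩ := ih h
    refine ⟨x, h1.trans h6, ⟨c, h1, h6, h5, h3, h7⟩, h4, fun e he => ?_⟩
    have := h9 e he
    have := he _ h2
    rw [List.length_cons]
    push_cast
    linarith

lemma bwd_of_chain {I : MTLI K} {f : ℝ → Set P} {l : List (MTL K P × MTL K P)} {q p : MTL K P}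
    {x y : ℝ} (hxy : x < y) (hI : ∀ t, 0 < t → t ≤ y - x → I.mem t) (h : Chain f l q x y)
    (hp : p.sat f x) : (bwd I p l q).sat f y := by
  induction l generalizing x p with
  | nil => exact ⟨x, hxy, hI _ (sub_pos.2 hxy) le_rfl, hp, h⟩
  | cons s l ih =>
    obtain ⟨c, h1, h2, h3, h4, h5⟩ := h
    exact ih h2 (fun t ht ht' => hI t ht (by linarith)) h5
      ⟨h4, x, h1, hI _ (sub_pos.2 h1) (by linarith), hp, h3⟩

/-- Properties of points definable in `MTL_K`. -/
def PtDef (K : AddSubgroup ℝ) {P : Type} (F : (ℝ → Set P) → ℝ → Prop) : Prop :=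
  ∃ ψ : MTL K P, ∀ f r, ψ.sat f r ↔ F f r

namespace PtDef

variable {F G : (ℝ → Set P) → ℝ → Prop}

lemma sat (ψ : MTL K P) : PtDef K fun f r => ψ.sat f r := ⟨ψ, fun _ _ => Iff.rfl⟩

lemma congr (h : PtDef K F) (h' : ∀ f r, F f r ↔ G f r) : PtDef K G :=
  let ⟨ψ, hψ⟩ := h; ⟨ψ, fun f r => (hψ f r).trans (h' f r)⟩

lemma true : PtDef K fun (_ : ℝ → Set P) _ => True := ⟨.tt, by simp⟩

lemma and (h : PtDef K F) (h' : PtDef K G) : PtDef K fun f r => F f r ∧ G f r :=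
  let ⟨ψ, hψ⟩ := h; let ⟨χ, hχ⟩ := h'; ⟨ψ.conj χ, by simp [hψ, hχ]⟩

lemma or (h : PtDef K F) (h' : PtDef K G) : PtDef K fun f r => F f r ∨ G f r :=
  let ⟨ψ, hψ⟩ := h; let ⟨χ, hχ⟩ := h'; ⟨ψ.disj χ, by simp [hψ, hχ]⟩

lemma not (h : PtDef K F) : PtDef K fun f r => ¬ F f r :=
  let ⟨ψ, hψ⟩ := h; ⟨ψ.neg, by simp [hψ]⟩

lemma shift (h : PtDef K F) (c : K) : PtDef K fun f r => F f (r + c) :=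
  let ⟨ψ, hψ⟩ := h; ⟨ψ.shift c, by simp [hψ]⟩

lemma const (p : Prop) : PtDef K fun (_ : ℝ → Set P) _ => p := by
  by_cases h : p
  · exact true.congr fun _ _ => by simp [h]
  · exact true.not.congr fun _ _ => by simp [h]

lemma holdsOn_right (q : MTL K P) (d : K) : PtDef K fun f r => HoldsOn f q r (r + d) := by
  by_cases hd : 0 < (d : ℝ)
  · refine (sat (.neg (.untl .tt q.neg (.upto d hd)))).congr fun f r => ?_
    simp only [MTL.sat_neg, MTL.sat_untl, MTLI.mem_upto, holdsOn_tt, and_true, not_exists,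
      not_and, not_not]
    exact ⟨fun h u h1 h2 => h u h1 ⟨by linarith, by linarith⟩,
      fun h u h1 h2 => h u h1 (by linarith)⟩
  · exact true.congr fun f r => (iff_true_left trivial).2 fun u h1 h2 => by linarith

lemma holdsOn_left (q : MTL K P) (d : K) : PtDef K fun f r => HoldsOn f q (r - d) r :=
  ((holdsOn_right q d).shift (-d)).congr fun f r => by
    push_cast
    rw [neg_add_cancel_right, ← sub_eq_add_neg]

lemma forall_Ioc (q : MTL K P) (d : K) :
    PtDef K fun f r => ∀ u, r < u → u ≤ r + d → q.sat f u := by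
  by_cases hd : 0 < (d : ℝ)
  · refine ((holdsOn_right q d).and ((sat q).shift d)).congr fun f r => ?_
    constructor
    · rintro ⟨h1, h2⟩ u h3 h4
      rcases h4.eq_or_lt with rfl | h4
      exacts [h2, h1 u h3 h4]
    · exact fun h => ⟨fun u h1 h2 => h u h1 h2.le, h _ (by linarith) le_rfl⟩
  · exact true.congr fun f r => (iff_true_left trivial).2 fun u h1 h2 => by linarith

lemma forall_Ico (q : MTL K P) (c d : K) :
    PtDef K fun f r => ∀ u, r + c ≤ u → u < r + d → q.sat f u := by
  by_cases hd : (c : ℝ) < d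
  · refine (((holdsOn_right q (d - c)).and (sat q)).shift c).congr fun f r => ?_
    have h0 : r + c + ((d - c : K) : ℝ) = r + d := by push_cast; ring
    rw [h0]
    constructor
    · rintro ⟨h1, h2⟩ u h3 h4
      rcases h3.eq_or_lt with rfl | h3
      exacts [h2, h1 u h3 h4]
    · exact fun h => ⟨fun u h1 h2 => h u h1.le h2, h _ le_rfl (by linarith)⟩
  · exact true.congr fun f r => (iff_true_left trivial).2 fun u h1 h2 => by linarith

lemma exists_gt {R : (ℝ → Set P) → ℝ → ℝ → Prop} (hR : SegDef K R) (p : MTL K P) :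
    PtDef K fun f a => ∃ b, a < b ∧ R f a b ∧ p.sat f b := by
  replace hR := hR.chainDef
  induction hR with
  | chain p' l q p'' =>
    refine (sat (.conj p' (fwd .full l q (p''.conj p)))).congr fun f a => ?_
    rw [MTL.sat_conj]
    constructor
    · rintro ⟨h, h'⟩
      obtain ⟨b, h1, h2, h3, -⟩ := exists_chain_of_fwd h'
      exact ⟨b, h1, ⟨h, h2, h3.1⟩, h3.2⟩
    · rintro ⟨b, h1, ⟨h, h2, h3⟩, h4⟩
      exact ⟨h, fwd_of_chain h1 (by simp +contextual) h2 ⟨h3, h4⟩⟩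
  | or _ _ ih ih' =>
    exact (ih.or ih').congr fun f a => by simp only [← exists_or, ← and_or_left, ← or_and_right]
  | congr _ h ih =>
    exact ih.congr fun f a => exists_congr fun b => and_congr_right fun hab =>
      and_congr_left fun _ => h f a b hab

lemma exists_lt {R : (ℝ → Set P) → ℝ → ℝ → Prop} (hR : SegDef K R) (p : MTL K P) :
    PtDef K fun f b => ∃ a, a < b ∧ R f a b ∧ p.sat f a := by
  replace hR := hR.chainDef
  induction hR with
  | chain p' l q p'' =>
    refine (sat (.conj p'' (bwd .full (p'.conj p) l q))).congr fun f b => ?_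
    rw [MTL.sat_conj]
    constructor
    · rintro ⟨h, h'⟩
      obtain ⟨a, h1, h2, h3, -⟩ := exists_chain_of_bwd h'
      exact ⟨a, h1, ⟨h3.1, h2, h⟩, h3.2⟩
    · rintro ⟨a, h1, ⟨h, h2, h3⟩, h4⟩
      exact ⟨h3, bwd_of_chain h1 (by simp +contextual) h2 ⟨h, h4⟩⟩
  | or _ _ ih ih' =>
    exact (ih.or ih').congr fun f a => by simp only [← exists_or, ← and_or_left, ← or_and_right]
  | congr _ h ih =>
    exact ih.congr fun f b => exists_congr fun a => and_congr_right fun hab =>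
      and_congr_left fun _ => h f a b hab

end PtDef

/-- Some `MTL_K` formula is implied by `F` and implies `G`. -/
def Interp (K : AddSubgroup ℝ) {P : Type} (F G : (ℝ → Set P) → ℝ → Prop) : Prop :=
  ∃ ψ : MTL K P, ∀ f r, (F f r → ψ.sat f r) ∧ (ψ.sat f r → G f r)

lemma PtDef.interp {F G : (ℝ → Set P) → ℝ → Prop} (h : PtDef K F) (h' : ∀ f r, F f r → G f r) :
    Interp K F G :=
  let ⟨ψ, hψ⟩ := h; ⟨ψ, fun f r => ⟨(hψ f r).2, fun h => h' f r ((hψ f r).1 h)⟩⟩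

lemma Interp.mono {F F' G : (ℝ → Set P) → ℝ → Prop} (h : Interp K F G)
    (h' : ∀ f r, F' f r → F f r) : Interp K F' G :=
  let ⟨ψ, hψ⟩ := h; ⟨ψ, fun f r => ⟨fun h => (hψ f r).1 (h' f r h), (hψ f r).2⟩⟩

lemma Interp.exists_list {ι : Type*} {F : ι → (ℝ → Set P) → ℝ → Prop}
    {G : (ℝ → Set P) → ℝ → Prop} (L : List ι) (h : ∀ i ∈ L, Interp K (F i) G) :
    Interp K (fun f r => ∃ i ∈ L, F i f r) G := by
  induction L with
  | nil => exact ⟨.ff, by simp⟩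
  | cons i L ih =>
    obtain ⟨ψ, hψ⟩ := h i (by simp)
    obtain ⟨χ, hχ⟩ := ih fun j hj => h j (by simp [hj])
    refine ⟨ψ.disj χ, fun f r => ?_⟩
    simp only [MTL.sat_disj, List.exists_mem_cons_iff]
    exact ⟨Or.imp (hψ f r).1 (hχ f r).1, fun h => h.elim (hψ f r).2 (hχ f r).2⟩

lemma DenseK.exists_mul_le (hK : DenseK K) {d : K} (hd : 0 < (d : ℝ)) (m : ℕ) :
    ∃ e : K, 0 < (e : ℝ) ∧ m * (e : ℝ) ≤ d := by
  induction m with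
  | zero => exact ⟨d, hd, by simpa using hd.le⟩
  | succ m ih =>
    obtain ⟨e, he, hm⟩ := ih
    obtain ⟨c, hc, h0, hce⟩ := hK 0 (zero_mem K) e e.2 he
    obtain ⟨e', he', h1, h2⟩ : ∃ e' ∈ K, 0 < e' ∧ 2 * e' ≤ (e : ℝ) := by
      rcases le_total (2 * c) e with h | h
      · exact ⟨c, hc, h0, h⟩
      · exact ⟨e - c, sub_mem e.2 hc, by linarith, by linarith⟩
    rcases Nat.eq_zero_or_pos m with rfl | hm0
    · exact ⟨d, hd, by simp⟩
    · refine ⟨⟨e', he'⟩, h1, ?_⟩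
      have : (1 : ℝ) ≤ m := by exact_mod_cast hm0
      push_cast
      nlinarith

lemma Chain.prepend {f : ℝ → Set P} {l : List (MTL K P × MTL K P)} {q q' p : MTL K P} {a c b : ℝ}
    (h : Chain f ((q', p) :: l) q c b) (hac : a ≤ c) (hq : ∀ u, a < u → u ≤ c → q'.sat f u) :
    Chain f ((q', p) :: l) q a b := by
  obtain ⟨d, h1, h2, h3, h4⟩ := h
  refine ⟨d, hac.trans_lt h1, h2, fun u hu hu' => ?_, h4⟩
  rcases le_or_gt u c with h | h
  exacts [hq u hu h, h3 u h hu']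

lemma Chain.extend {f : ℝ → Set P} {l : List (MTL K P × MTL K P)} {q : MTL K P} {a b b' : ℝ}
    (h : Chain f l q a b) (hb : b ≤ b') (hq : ∀ u, b ≤ u → u < b' → q.sat f u) :
    Chain f l q a b' := by
  induction l generalizing a with
  | nil =>
    intro u hu hu'
    rcases le_or_gt b u with h' | h'
    exacts [hq u h' hu', h u hu h']
  | cons s l ih =>
    obtain ⟨d, h1, h2, h3, h4, h5⟩ := h
    exact ⟨d, h1, h2.trans_le hb, h3, h4, ih h5⟩

/-- A decomposition of `(x, x + d)` whose division points lie in `(x + s, x + t)`. -/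
def Win (f : ℝ → Set P) (q' p : MTL K P) (l : List (MTL K P × MTL K P)) (q : MTL K P)
    (d s t : K) (x : ℝ) : Prop :=
  (∀ u, x < u → u ≤ x + s → q'.sat f u) ∧ Chain f ((q', p) :: l) q (x + s) (x + t) ∧
    ∀ u, x + t ≤ u → u < x + d → q.sat f u

lemma Win.chain {f : ℝ → Set P} {q' p : MTL K P} {l : List (MTL K P × MTL K P)} {q : MTL K P}
    {d s t : K} {x : ℝ} (h : Win f q' p l q d s t x) (hs : 0 ≤ (s : ℝ)) (ht : (t : ℝ) ≤ d) :
    Chain f ((q', p) :: l) q x (x + d) :=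
  (h.2.1.extend (by linarith) h.2.2).prepend (by linarith) h.1

lemma interp_win_forward (q' p : MTL K P) (l : List (MTL K P × MTL K P)) (q : MTL K P)
    (d s t e : K) (hs : 0 ≤ (s : ℝ)) (hst : (s : ℝ) < t) (hte : (t : ℝ) ≤ s + e)
    (hd : (s : ℝ) + ((l.length : ℝ) + 2) * (2 * e) < d) :
    Interp K (fun f x => Win f q' p l q d s t x)
      fun f x => Chain f ((q', p) :: l) q x (x + d) := by
  have he : 0 < (e : ℝ) := by linarith
  obtain ⟨χ, hχ⟩ := PtDef.holdsOn_right q e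
  have he2 : 0 < ((e + e : K) : ℝ) := by push_cast; linarith
  have hl : (0 : ℝ) ≤ l.length * (e : ℝ) := by positivity
  have hF := (PtDef.forall_Ioc q' s).and (((PtDef.sat
    (fwd (.upto (e + e) he2) ((q', p) :: l) q (.conj q χ))).shift s).and (PtDef.forall_Ico q t d))
  refine (hF.interp fun f x => ?_).mono fun f x => ?_
  · rintro ⟨h1, h2, h3⟩
    obtain ⟨y, hxy, hC, ⟨hy, hy'⟩, hle⟩ := exists_chain_of_fwd h2
    rw [hχ] at hy'
    have hyd := hle (2 * e) fun r hr => by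
      have := ((MTLI.mem_upto _ _ _).1 hr).2
      push_cast at this
      linarith
    rw [List.length_cons] at hyd
    push_cast at hyd
    refine (hC.extend (b' := x + d) (by linarith) fun u hu hu' => ?_).prepend (by linarith) h1
    rcases le_or_gt (x + t) u with h | h
    · exact h3 u h hu'
    rcases hu.eq_or_lt with rfl | hu
    · exact hy
    · exact hy' u hu (by linarith)
  · rintro ⟨h1, h2, h3⟩
    refine ⟨h1, fwd_of_chain (by linarith) (fun r hr hr' => ?_) h2
      ⟨h3 _ le_rfl (by linarith), (hχ _ _).2 fun u hu hu' => h3 u hu.le (by linarith)⟩, h3⟩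
    rw [MTLI.mem_upto]
    push_cast
    exact ⟨hr, by linarith⟩

lemma interp_win_backward (q' p : MTL K P) (l : List (MTL K P × MTL K P)) (q : MTL K P)
    (d s t e : K) (ht : (t : ℝ) ≤ d) (hst : (s : ℝ) < t) (hte : (t : ℝ) ≤ s + e)
    (hd : ((l.length : ℝ) + 2) * (2 * e) ≤ s) :
    Interp K (fun f x => Win f q' p l q d s t x)
      fun f x => Chain f ((q', p) :: l) q x (x + d) := by
  have he : 0 < (e : ℝ) := by linarith
  obtain ⟨χ, hχ⟩ := PtDef.holdsOn_left q' e
  have he2 : 0 < ((e + e : K) : ℝ) := by push_cast; linarith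
  have hl : (0 : ℝ) ≤ l.length * (e : ℝ) := by positivity
  have hF := (PtDef.forall_Ioc q' s).and (((PtDef.sat
    (bwd (.upto (e + e) he2) (.conj q' χ) ((q', p) :: l) q)).shift t).and (PtDef.forall_Ico q t d))
  refine (hF.interp fun f x => ?_).mono fun f x => ?_
  · rintro ⟨h1, h2, h3⟩
    obtain ⟨y, hxy, hC, ⟨hy, hy'⟩, hle⟩ := exists_chain_of_bwd h2
    rw [hχ] at hy'
    have hyd := hle (2 * e) fun r hr => by
      have := ((MTLI.mem_upto _ _ _).1 hr).2
      push_cast at this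
      linarith
    rw [List.length_cons] at hyd
    push_cast at hyd
    refine (hC.extend (b' := x + d) (by linarith) h3).prepend (by linarith) fun u hu hu' => ?_
    rcases le_or_gt u (x + s) with h | h
    · exact h1 u hu h
    rcases hu'.eq_or_lt with rfl | hu'
    · exact hy
    · exact hy' u (by linarith) hu'
  · rintro ⟨h1, h2, h3⟩
    refine ⟨h1, bwd_of_chain (x := x + s) (by linarith) (fun r hr hr' => ?_) h2
      ⟨h1 _ (by linarith) le_rfl, (hχ _ _).2 fun u hu hu' => h1 u (by linarith) hu'.le⟩, h3⟩
    rw [MTLI.mem_upto]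
    push_cast
    exact ⟨hr, by linarith⟩

/-- With a dense set of constants, decompositions of `(x, x + d)` are definable. -/
lemma ptDef_chain (hK : DenseK K) (l : List (MTL K P × MTL K P)) (q : MTL K P) (d : K)
    (hd : 0 < (d : ℝ)) : PtDef K fun f x => Chain f l q x (x + d) := by
  induction hn : l.length using Nat.strong_induction_on generalizing l q d with
  | _ n ih =>
  subst hn
  have ih' : ∀ (l' : List (MTL K P × MTL K P)) (q' : MTL K P), l'.length < l.length → ∀ c c' : K,
      (c : ℝ) < c' → PtDef K fun f x => Chain f l' q' (x + c) (x + c') := fun l' q' h c c' hc =>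
    ((ih _ h l' q' (c' - c) (by push_cast; linarith) rfl).shift c).congr fun f x => by
      have : x + c + ((c' - c : K) : ℝ) = x + c' := by push_cast; ring
      rw [this]
  clear ih
  rcases l with - | ⟨⟨q', p⟩, l⟩
  · exact PtDef.holdsOn_right q d
  obtain ⟨e, he, hed⟩ := hK.exists_mul_le hd (4 * (l.length + 2) + 1)
  push_cast at hed
  have small : ∀ s t : K, 0 ≤ (s : ℝ) → (s : ℝ) < t → (t : ℝ) ≤ d → (t : ℝ) ≤ s + e →
      Interp K (fun f x => Win f q' p l q d s t x)
        fun f x => Chain f ((q', p) :: l) q x (x + d) := fun s t hs hst htd hte => by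
    rcases lt_or_ge ((s : ℝ) + ((l.length : ℝ) + 2) * (2 * e)) d with h | h
    · exact interp_win_forward q' p l q d s t e hs hst hte h
    · exact interp_win_backward q' p l q d s t e htd hst hte (by linarith)
  have merge : ∀ s c t : K, 0 ≤ (s : ℝ) → (s : ℝ) < c → (c : ℝ) < t → (t : ℝ) ≤ d →
      Interp K (fun f x => Win f q' p l q d s c x)
        (fun f x => Chain f ((q', p) :: l) q x (x + d)) →
      Interp K (fun f x => Win f q' p l q d c t x)
        (fun f x => Chain f ((q', p) :: l) q x (x + d)) →
      Interp K (fun f x => Win f q' p l q d s t x)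
        (fun f x => Chain f ((q', p) :: l) q x (x + d)) := fun s c t hs hsc hct htd h1 h2 => by
    refine (Interp.exists_list (F := fun σ f x => (∀ u, x < u → u ≤ x + s → q'.sat f u) ∧
      (Chain f σ.1.1 σ.1.2 (x + s) (x + c) ∧ σ.2.1.sat f (x + c) ∧
        Chain f σ.2.2.1 σ.2.2.2 (x + c) (x + t)) ∧ ∀ u, x + t ≤ u → u < x + d → q.sat f u)
      (cuts ((q', p) :: l) q) fun σ hσ => ?_).mono fun f x => ?_
    · rcases length_left_of_mem_cuts hσ with hl | rfl
      · rcases length_right_of_mem_cuts hσ with hr | rfl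
        · refine ((PtDef.forall_Ioc q' s).and (((ih' _ _ hl s c hsc).and
            (((PtDef.sat σ.2.1).shift c).and (ih' _ _ hr c t hct))).and
            (PtDef.forall_Ico q t d))).interp fun f x h => ?_
          refine Win.chain ⟨h.1, ?_, h.2.2⟩ hs htd
          exact (chain_cut (by linarith) (by linarith)).2 ⟨σ, hσ, h.2.1⟩
        · refine h2.mono fun f x => ?_
          rintro ⟨h3, ⟨h4, h5, h6⟩, h7⟩
          refine ⟨fun u hu hu' => ?_, h6, h7⟩
          rcases le_or_gt u (x + s) with h | h
          · exact h3 u hu h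
          rcases hu'.eq_or_lt with rfl | hu'
          exacts [h5, h4 u h hu']
      · refine h1.mono fun f x => ?_
        rintro ⟨h3, ⟨h4, h5, h6⟩, h7⟩
        refine ⟨h3, h4, fun u hu hu' => ?_⟩
        rcases le_or_gt (x + t) u with h | h
        · exact h7 u h hu'
        rcases hu.eq_or_lt with rfl | hu
        exacts [h5, h6 u hu h]
    · rintro ⟨h3, h4, h5⟩
      obtain ⟨σ, hσ, h⟩ := (chain_cut (c := x + c) (by linarith) (by linarith)).1 h4
      exact ⟨σ, hσ, h3, h, h5⟩
  have cells : ∀ (k : ℕ) (s t : K), 0 ≤ (s : ℝ) → (s : ℝ) < t → (t : ℝ) ≤ d →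
      (t : ℝ) ≤ s + k * (e : ℝ) → Interp K (fun f x => Win f q' p l q d s t x)
        fun f x => Chain f ((q', p) :: l) q x (x + d) := fun k => by
    induction k with
    | zero => exact fun s t _ hst _ h => absurd hst (by simpa using h)
    | succ k ihk =>
      intro s t hs hst htd h
      rcases le_or_gt (t : ℝ) (s + e) with hte | hte
      · exact small s t hs hst htd hte
      · have hse : ((s + e : K) : ℝ) = s + e := rfl
        push_cast at h
        refine merge s (s + e) t hs (by linarith) (by linarith) htd
          (small _ _ hs (by linarith) (by linarith) (by linarith))
          (ihk _ _ (by linarith) (by linarith) htd (by linarith))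
  obtain ⟨k, hk⟩ := exists_nat_ge ((d : ℝ) / e)
  rw [div_le_iff₀ he] at hk
  obtain ⟨ψ, hψ⟩ := cells k 0 d (by simp) (by simpa using hd) le_rfl (by simpa using hk)
  refine ⟨ψ, fun f x => ⟨(hψ f x).2, fun h =>
    (hψ f x).1 ⟨fun u hu hu' => ?_, ?_, fun u hu hu' => ?_⟩⟩⟩
  · exact absurd hu (by simpa using hu')
  · simpa using h
  · exact absurd hu' (not_lt.2 hu)

lemma SegDef.ptDef {R : (ℝ → Set P) → ℝ → ℝ → Prop} (hK : DenseK K) (hR : SegDef K R) (d : K)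
    (hd : 0 < (d : ℝ)) : PtDef K fun f x => R f x (x + d) := by
  replace hR := hR.chainDef
  induction hR with
  | chain p l q p' =>
    exact (PtDef.sat p).and ((ptDef_chain hK l q d hd).and ((PtDef.sat p').shift d))
  | or _ _ ih ih' => exact ih.or ih'
  | congr _ h ih => exact ih.congr fun f x => h f _ _ (by linarith)

/-- Relations on signals and valuations which are boolean combinations of `MTL_K` formulas at
terms and of relations in `SegDef` between terms. -/
inductive GridDef (K : AddSubgroup ℝ) {P : Type} : ((ℝ → Set P) → (ℕ → ℝ) → Prop) → Prop
  | pt (t : Term K) (ψ : MTL K P) : GridDef K fun f v => ψ.sat f (t.val v)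
  | rel (s t : Term K) {R} : SegDef K R →
      GridDef K fun f v => s.val v < t.val v ∧ R f (s.val v) (t.val v)
  | and {W W'} : GridDef K W → GridDef K W' → GridDef K fun f v => W f v ∧ W' f v
  | not {W} : GridDef K W → GridDef K fun f v => ¬ W f v
  | congr {W V} : GridDef K W → (∀ f v, W f v ↔ V f v) → GridDef K V

namespace GridDef

variable {W W' : (ℝ → Set P) → (ℕ → ℝ) → Prop}

lemma or (h : GridDef K W) (h' : GridDef K W') : GridDef K fun f v => W f v ∨ W' f v :=
  (h.not.and h'.not).not.congr fun _ _ => by tauto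

lemma true : GridDef K fun (_ : ℝ → Set P) _ => True :=
  (pt (0, 0) .tt).congr fun _ _ => by simp

lemma lt (s t : Term K) : GridDef K fun (_ : ℝ → Set P) v => s.val v < t.val v :=
  (rel s t .true).congr fun _ _ => by simp

lemma eq (s t : Term K) : GridDef K fun (_ : ℝ → Set P) v => s.val v = t.val v :=
  ((lt s t).not.and (lt t s).not).congr fun _ _ => by
    rw [not_lt, not_lt, le_antisymm_iff, and_comm]

lemma ofPtDef {F : (ℝ → Set P) → ℝ → Prop} (h : PtDef K F) (t : Term K) :
    GridDef K fun f v => F f (t.val v) :=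
  let ⟨ψ, hψ⟩ := h; (pt t ψ).congr fun f _ => hψ f _

end GridDef

/-- Lower bounds of a cell. -/
inductive LowDef (K : AddSubgroup ℝ) {P : Type} : ((ℝ → Set P) → (ℕ → ℝ) → ℝ → Prop) → Prop
  | none : LowDef K fun _ _ _ => True
  | some (g : Term K) {A} : SegDef K A → LowDef K fun f v r => g.val v < r ∧ A f (g.val v) r

/-- Upper bounds of a cell. -/
inductive UpDef (K : AddSubgroup ℝ) {P : Type} : ((ℝ → Set P) → (ℕ → ℝ) → ℝ → Prop) → Prop
  | none : UpDef K fun _ _ _ => True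
  | some (h : Term K) {B} : SegDef K B → UpDef K fun f v r => r < h.val v ∧ B f r (h.val v)

/-- Finite unions of lower bounds, each subject to a condition on the parameters. -/
inductive LowsDef (K : AddSubgroup ℝ) {P : Type} : ((ℝ → Set P) → (ℕ → ℝ) → ℝ → Prop) → Prop
  | mk {W L} : GridDef K W → LowDef K L → LowsDef K fun f v r => W f v ∧ L f v r
  | or {L L'} : LowsDef K L → LowsDef K L' → LowsDef K fun f v r => L f v r ∨ L' f v r
  | congr {L M} : LowsDef K L → (∀ f v r, L f v r ↔ M f v r) → LowsDef K M

/-- Finite unions of upper bounds, each subject to a condition on the parameters. -/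
inductive UpsDef (K : AddSubgroup ℝ) {P : Type} : ((ℝ → Set P) → (ℕ → ℝ) → ℝ → Prop) → Prop
  | mk {W U} : GridDef K W → UpDef K U → UpsDef K fun f v r => W f v ∧ U f v r
  | or {U U'} : UpsDef K U → UpsDef K U' → UpsDef K fun f v r => U f v r ∨ U' f v r
  | congr {U V} : UpsDef K U → (∀ f v r, U f v r ↔ V f v r) → UpsDef K V

lemma lowsDef_of_lt {A : (ℝ → Set P) → ℝ → ℝ → Prop} {T : (ℝ → Set P) → ℝ → ℝ → ℝ → Prop}
    (g g' : Term K) (hT : CutDef K T) (hA : SegDef K A) : LowsDef K fun f v r =>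
      g.val v < g'.val v ∧ g'.val v < r ∧ T f (g.val v) (g'.val v) r ∧ A f (g'.val v) r := by
  induction hT with
  | prod p hR hS =>
    exact (LowsDef.mk ((GridDef.rel g g' hR).and (.pt g' p)) (.some g' (hS.and hA))).congr
      fun f v r => by tauto
  | or _ _ ih ih' => exact (ih.or ih').congr fun f v r => by tauto
  | congr _ h ih =>
    exact ih.congr fun f v r => and_congr_right fun h1 => and_congr_right fun h2 =>
      and_congr_left fun _ => h f _ _ _ h1 h2

lemma LowDef.and {L L' : (ℝ → Set P) → (ℕ → ℝ) → ℝ → Prop} (h : LowDef K L) (h' : LowDef K L') :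
    LowsDef K fun f v r => L f v r ∧ L' f v r := by
  cases h with
  | none => exact (LowsDef.mk .true h').congr fun _ _ _ => Iff.rfl
  | some g hA =>
    cases h' with
    | none => exact (LowsDef.mk .true (.some g hA)).congr fun _ _ _ => by simp
    | some g' hA' =>
      refine ((lowsDef_of_lt g g' hA.cut hA').or ((LowsDef.mk (.eq g g')
        (.some g (hA.and hA'))).or (lowsDef_of_lt g' g hA'.cut hA))).congr fun f v r => ?_
      constructor
      · rintro (⟨h1, h2, h3, h4⟩ | ⟨h1, h2, h3, h4⟩ | ⟨h1, h2, h3, h4⟩)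
        · exact ⟨⟨h1.trans h2, h3⟩, h2, h4⟩
        · beta_reduce
          rw [← h1]
          exact ⟨⟨h2, h3⟩, h2, h4⟩
        · exact ⟨⟨h2, h4⟩, h1.trans h2, h3⟩
      · rintro ⟨⟨h1, h2⟩, h3, h4⟩
        rcases lt_trichotomy (g.val v) (g'.val v) with h | h | h
        · exact Or.inl ⟨h, h3, h2, h4⟩
        · rw [← h] at h4
          exact Or.inr (Or.inl ⟨h, h1, h2, h4⟩)
        · exact Or.inr (Or.inr ⟨h, h1, h4, h2⟩)

lemma upsDef_of_lt {B : (ℝ → Set P) → ℝ → ℝ → Prop} {T : (ℝ → Set P) → ℝ → ℝ → ℝ → Prop}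
    (h h' : Term K) (hT : CutDef K T) (hB : SegDef K B) : UpsDef K fun f v r =>
      r < h.val v ∧ h.val v < h'.val v ∧ T f r (h.val v) (h'.val v) ∧ B f r (h.val v) := by
  induction hT with
  | prod p hR hS =>
    exact (UpsDef.mk ((GridDef.rel h h' hS).and (.pt h p)) (.some h (hR.and hB))).congr
      fun f v r => by tauto
  | or _ _ ih ih' => exact (ih.or ih').congr fun f v r => by tauto
  | congr _ h ih =>
    exact ih.congr fun f v r => and_congr_right fun h1 => and_congr_right fun h2 =>
      and_congr_left fun _ => h f _ _ _ h1 h2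

lemma UpDef.and {U U' : (ℝ → Set P) → (ℕ → ℝ) → ℝ → Prop} (h : UpDef K U) (h' : UpDef K U') :
    UpsDef K fun f v r => U f v r ∧ U' f v r := by
  cases h with
  | none => exact (UpsDef.mk .true h').congr fun _ _ _ => Iff.rfl
  | some g hA =>
    cases h' with
    | none => exact (UpsDef.mk .true (.some g hA)).congr fun _ _ _ => by simp
    | some g' hA' =>
      refine ((upsDef_of_lt g g' hA'.cut hA).or ((UpsDef.mk (.eq g g')
        (.some g (hA.and hA'))).or (upsDef_of_lt g' g hA.cut hA'))).congr fun f v r => ?_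
      constructor
      · rintro (⟨h1, h2, h3, h4⟩ | ⟨h1, h2, h3, h4⟩ | ⟨h1, h2, h3, h4⟩)
        · exact ⟨⟨h1, h4⟩, h1.trans h2, h3⟩
        · beta_reduce
          rw [← h1]
          exact ⟨⟨h2, h3⟩, h2, h4⟩
        · exact ⟨⟨h1.trans h2, h3⟩, h1, h4⟩
      · rintro ⟨⟨h1, h2⟩, h3, h4⟩
        rcases lt_trichotomy (g.val v) (g'.val v) with h | h | h
        · exact Or.inl ⟨h1, h, h4, h2⟩
        · rw [← h] at h4
          exact Or.inr (Or.inl ⟨h, h1, h2, h4⟩)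
        · exact Or.inr (Or.inr ⟨h3, h, h2, h4⟩)

/-- Relations between a signal, a valuation and a point that are finite unions of cells. -/
inductive CellDef (K : AddSubgroup ℝ) {P : Type} : ((ℝ → Set P) → (ℕ → ℝ) → ℝ → Prop) → Prop
  | cell {W L U} (p : MTL K P) : GridDef K W → LowDef K L → UpDef K U →
      CellDef K fun f v r => W f v ∧ L f v r ∧ p.sat f r ∧ U f v r
  | eq {W} (e : Term K) : GridDef K W → CellDef K fun f v r => W f v ∧ r = e.val v
  | or {C D} : CellDef K C → CellDef K D → CellDef K fun f v r => C f v r ∨ D f v r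
  | congr {C D} : CellDef K C → (∀ f v r, C f v r ↔ D f v r) → CellDef K D

namespace CellDef

variable {C D L U : (ℝ → Set P) → (ℕ → ℝ) → ℝ → Prop} {W : (ℝ → Set P) → (ℕ → ℝ) → Prop}

lemma ofGrid (h : GridDef K W) : CellDef K fun f v _ => W f v :=
  (cell .tt h .none .none).congr fun _ _ _ => by simp

lemma ofPtDef {F : (ℝ → Set P) → ℝ → Prop} (h : PtDef K F) : CellDef K fun f _ r => F f r :=
  let ⟨ψ, hψ⟩ := h; (cell ψ .true .none .none).congr fun _ _ _ => by simp [hψ]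

lemma ofLow (h : LowDef K L) : CellDef K L :=
  (cell .tt .true h .none).congr fun _ _ _ => by simp

lemma ofUp (h : UpDef K U) : CellDef K U :=
  (cell .tt .true .none h).congr fun _ _ _ => by simp

lemma cells (hW : GridDef K W) (hL : LowsDef K L) (p : MTL K P) (hU : UpsDef K U) :
    CellDef K fun f v r => W f v ∧ L f v r ∧ p.sat f r ∧ U f v r := by
  induction hL with
  | or _ _ ih ih' => exact (ih.or ih').congr fun _ _ _ => by tauto
  | congr _ h ih => exact ih.congr fun f v r => by rw [h f v r]
  | mk hW' hL =>
    induction hU with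
    | or _ _ ih ih' => exact (ih.or ih').congr fun _ _ _ => by tauto
    | congr _ h ih => exact ih.congr fun f v r => by rw [h f v r]
    | mk hW'' hU =>
      exact (cell p (hW.and (hW'.and hW'')) hL hU).congr fun _ _ _ => by tauto

lemma eq_and (e : Term K) (hW : GridDef K W) (hD : CellDef K D) :
    CellDef K fun f v r => (W f v ∧ r = e.val v) ∧ D f v r := by
  suffices h : GridDef K fun f v => D f v (e.val v) by
    refine (eq e (hW.and h)).congr fun f v r => ?_
    constructor
    · rintro ⟨⟨h1, h2⟩, rfl⟩; exact ⟨⟨h1, rfl⟩, h2⟩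
    · rintro ⟨⟨h1, rfl⟩, h2⟩; exact ⟨⟨h1, h2⟩, rfl⟩
  induction hD with
  | or _ _ ih ih' => exact ih.or ih'
  | congr _ h ih => exact ih.congr fun f v => h f v _
  | eq e' hW' => exact hW'.and (.eq e e')
  | cell p hW' hL hU =>
    refine hW'.and (GridDef.and ?_ ((GridDef.pt e p).and ?_))
    · cases hL with
      | none => exact .true
      | some g hA => exact .rel g e hA
    · cases hU with
      | none => exact .true
      | some h hB => exact .rel e h hB

lemma and (hC : CellDef K C) (hD : CellDef K D) : CellDef K fun f v r => C f v r ∧ D f v r := by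
  induction hC with
  | or _ _ ih ih' => exact (ih.or ih').congr fun _ _ _ => or_and_right.symm
  | congr _ h ih => exact ih.congr fun f v r => by rw [h f v r]
  | eq e hW => exact eq_and e hW hD
  | cell p hW hL hU =>
    induction hD with
    | or _ _ ih ih' => exact (ih.or ih').congr fun _ _ _ => and_or_left.symm
    | congr _ h ih => exact ih.congr fun f v r => by rw [h f v r]
    | eq e hW' =>
      exact (eq_and e hW' (cell p hW hL hU)).congr fun _ _ _ => and_comm
    | cell p' hW' hL' hU' =>
      exact (cells (hW.and hW') (hL.and hL') (p.conj p') (hU.and hU')).congr fun _ _ _ => by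
        rw [MTL.sat_conj]; tauto

lemma not_low {L : (ℝ → Set P) → (ℕ → ℝ) → ℝ → Prop} (h : LowDef K L) :
    CellDef K fun f v r => ¬ L f v r := by
  cases h with
  | none => exact ofGrid (GridDef.true.not)
  | some g hA =>
    refine ((eq g .true).or ((ofUp (.some g .true)).or (ofLow (.some g hA.not)))).congr
      fun f v r => ?_
    rcases lt_trichotomy (g.val v) r with h | h | h
    · simp [h, h.ne', h.not_gt]
    · simp [h]
    · simp [h, h.not_gt]

lemma not_up {U : (ℝ → Set P) → (ℕ → ℝ) → ℝ → Prop} (h : UpDef K U) :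
    CellDef K fun f v r => ¬ U f v r := by
  cases h with
  | none => exact ofGrid (GridDef.true.not)
  | some g hA =>
    refine ((eq g .true).or ((ofLow (.some g .true)).or (ofUp (.some g hA.not)))).congr
      fun f v r => ?_
    rcases lt_trichotomy (g.val v) r with h | h | h
    · simp [h, h.not_gt]
    · simp [h]
    · simp [h, h.ne, h.not_gt]

lemma gridDef_exists (h : CellDef K C) : GridDef K fun f v => ∃ r, C f v r := by
  induction h with
  | or _ _ ih ih' => exact (ih.or ih').congr fun _ _ => exists_or.symm
  | congr _ h ih => exact ih.congr fun f v => exists_congr (h f v)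
  | eq e hW => exact hW.congr fun f v => by simp
  | cell p hW hL hU =>
    refine GridDef.congr (hW.and ?_) fun _ _ => exists_and_left.symm
    cases hL with
    | none =>
      cases hU with
      | none =>
        refine ((GridDef.pt (0, 0) p).or ((GridDef.pt (0, 0) (.untl .tt p .full)).or
          (.pt (0, 0) (.sinc .tt p .full)))).congr fun f v => ?_
        simp only [MTL.sat_untl, MTL.sat_sinc, holdsOn_tt, and_true, true_and]
        constructor
        · rintro (h | ⟨r, -, -, h⟩ | ⟨r, -, -, h⟩) <;> exact ⟨_, h⟩
        · rintro ⟨r, h⟩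
          rcases lt_trichotomy (Term.val v ((0, 0) : Term K)) r with h' | rfl | h'
          · exact Or.inr (Or.inl ⟨r, h', by simpa using h', h⟩)
          · exact Or.inl h
          · exact Or.inr (Or.inr ⟨r, h', by simpa using h', h⟩)
      | some h hB =>
        refine (GridDef.ofPtDef (PtDef.exists_lt hB p) h).congr fun f v => exists_congr fun r => ?_
        tauto
    | some g hA =>
      cases hU with
      | none =>
        refine (GridDef.ofPtDef (PtDef.exists_gt hA p) g).congr fun f v => exists_congr fun r => ?_
        tauto
      | some h hB =>
        refine (GridDef.rel g h (hA.comp p hB)).congr fun f v => ?_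
        constructor
        · rintro ⟨-, r, h1, h2, h3, h4, h5⟩
          exact ⟨r, ⟨h1, h3⟩, h4, h2, h5⟩
        · rintro ⟨r, ⟨h1, h3⟩, h4, h2, h5⟩
          exact ⟨h1.trans h2, r, h1, h2, h3, h4, h5⟩

end CellDef

lemma SegDef.ptDef_rel {R : (ℝ → Set P) → ℝ → ℝ → Prop} (hK : DenseK K) (hR : SegDef K R)
    (c d : K) : PtDef K fun f r => r + (c : ℝ) < r + d ∧ R f (r + c) (r + d) := by
  by_cases h : (c : ℝ) < d
  · refine ((hR.ptDef hK (d - c) (by push_cast; linarith)).shift c).congr fun f r => ?_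
    simp [h]
  · exact (PtDef.const False).congr fun f r => by simp [h]

lemma Term.val_update_self (v : ℕ → ℝ) (x : ℕ) (c : K) (r : ℝ) :
    Term.val (Function.update v x r) ((x, c) : Term K) = r + c := by simp [Term.val]

lemma Term.val_update_of_ne (v : ℕ → ℝ) {x : ℕ} {t : Term K} (h : t.1 ≠ x) (r : ℝ) :
    Term.val (Function.update v x r) t = t.val v := by simp [Term.val, h]

lemma Term.val_sub (v : ℕ → ℝ) (t : Term K) (c : K) :
    Term.val v ((t.1, t.2 - c) : Term K) = t.val v - c := by
  simp only [Term.val]; push_cast; ring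

/-- Viewing one variable as a point, a boolean combination and its complement are finite unions
of cells. -/
lemma GridDef.cellDef {W : (ℝ → Set P) → (ℕ → ℝ) → Prop} (hK : DenseK K) (h : GridDef K W)
    (x : ℕ) : (CellDef K fun f v r => W f (Function.update v x r)) ∧
      CellDef K fun f v r => ¬ W f (Function.update v x r) := by
  induction h with
  | pt t ψ =>
    by_cases ht : t.1 = x
    · obtain ⟨y, c⟩ := t
      obtain rfl : y = x := ht
      simp only [Term.val_update_self]
      have := (PtDef.sat ψ).shift c
      exact ⟨.ofPtDef this, .ofPtDef this.not⟩
    · simp only [Term.val_update_of_ne _ ht]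
      exact ⟨.ofGrid (.pt t ψ), .ofGrid (GridDef.pt t ψ).not⟩
  | and _ _ ih ih' =>
    exact ⟨ih.1.and ih'.1, (ih.2.or ih'.2).congr fun _ _ _ => not_and_or.symm⟩
  | not _ ih => exact ⟨ih.2, ih.1.congr fun _ _ _ => not_not.symm⟩
  | congr _ h ih =>
    exact ⟨ih.1.congr fun f _ _ => h f _, ih.2.congr fun f _ _ => not_congr (h f _)⟩
  | @rel s t R hR =>
    by_cases hs : s.1 = x <;> by_cases ht : t.1 = x
    · obtain ⟨y, c⟩ := s
      obtain rfl : y = x := hs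
      obtain ⟨z, d⟩ := t
      obtain rfl : z = y := ht
      simp only [Term.val_update_self]
      have := hR.ptDef_rel hK c d
      exact ⟨.ofPtDef this, .ofPtDef this.not⟩
    · obtain ⟨y, c⟩ := s
      obtain rfl : y = x := hs
      simp only [Term.val_update_self, Term.val_update_of_ne _ ht]
      have hU := UpDef.some (t.1, t.2 - c) (hR.shift c)
      simp only [Term.val_sub, sub_add_cancel, lt_sub_iff_add_lt] at hU
      exact ⟨.ofUp hU, .not_up hU⟩
    · obtain ⟨y, c⟩ := t
      obtain rfl : y = x := ht
      simp only [Term.val_update_self, Term.val_update_of_ne _ hs]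
      have hL := LowDef.some (s.1, s.2 - c) (hR.shift c)
      simp only [Term.val_sub, sub_add_cancel, sub_lt_iff_lt_add] at hL
      exact ⟨.ofLow hL, .not_low hL⟩
    · simp only [Term.val_update_of_ne _ hs, Term.val_update_of_ne _ ht]
      exact ⟨.ofGrid (.rel s t hR), .ofGrid (GridDef.rel s t hR).not⟩

lemma FO.gridDef (hK : DenseK K) (φ : FO K P) : GridDef K fun f v => φ.sat f v := by
  induction φ with
  | tt => exact .true
  | atom p t => exact .pt t (.atom p)
  | lt s t => exact .lt s t
  | conj φ ψ ih ih' => exact ih.and ih'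
  | neg φ ih => exact ih.not
  | ex x φ ih => exact (ih.cellDef hK x).1.gridDef_exists

lemma GridDef.ptDef {W : (ℝ → Set P) → (ℕ → ℝ) → Prop} (hK : DenseK K) (h : GridDef K W) :
    PtDef K fun f r => W f fun _ => r := by
  induction h with
  | pt t ψ => exact (PtDef.sat ψ).shift t.2
  | rel s t hR => exact hR.ptDef_rel hK s.2 t.2
  | and _ _ ih ih' => exact ih.and ih'
  | not _ ih => exact ih.not
  | congr _ h ih => exact ih.congr fun f _ => h f _

/-- **Lemma 6.** Let `K` be a dense additive subgroup of `ℝ`.  Any `N`-bounded `FO_K`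
formula with one free variable is equivalent to an `MTL_K` formula. -/
theorem bounded_expressive_completeness (K : AddSubgroup ℝ) (hK : DenseK K)
    (N : K) (hN : 0 ≤ (N : ℝ))
    (φ : FO K ℕ) (hfree : φ.free ⊆ {0}) (hb : φ.NBounded 0 N) :
    ∃ ψ : MTL K ℕ, EquivFOMTL φ ψ := by
  obtain ⟨ψ, hψ⟩ := (φ.gridDef hK).ptDef hK
  exact ⟨ψ, fun f r => (hψ f r).symm⟩

end MTLPaper
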